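/- arXiv:1205.3264 — 3 statements merged into one kernel-verified Lean document; each statement's English description precedes it below -/
import Mathlib

section
/- Let E be a topological graph and let (ψ, π) be a covariant Toeplitz representation of E in a C*-algebra B. Then for every nonnegative f ∈ C_c(E⁰_rg), every finite cover 𝒩 of r⁻¹(supp(f)) by open s-sections, and every collection of nonnegative functions f_N ∈ C_c(E¹) (N ∈ 𝒩) such that osupp(f_N) ⊆ N ∩ r⁻¹(supp(f)) for each N and Σ_{N∈𝒩} f_N = f∘r, one has π(f) = Σ_{N∈𝒩} ψ(√f_N) ψ(√f_N)*. -/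
open scoped ZeroAtInfty CompactlySupported ComplexOrder

noncomputable section

namespace TopGraphPaper

variable {V G : Type*} [TopologicalSpace V] [TopologicalSpace G]

/-- The set `E⁰_fin` of vertices having a neighbourhood `N` with `r⁻¹(N)` compact. -/
def Efin (r : G → V) : Set V := {v | ∃ N ∈ nhds v, IsCompact (r ⁻¹' N)}

/-- The set `E⁰_sce = E⁰ \ closure (r(E¹))`. -/
def Esce (r : G → V) : Set V := (closure (Set.range r))ᶜ

/-- The set `E⁰_rg = E⁰_fin \ closure (E⁰_sce)`. -/
def Erg (r : G → V) : Set V := Efin r \ closure (Esce r)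

/-- `U ⊆ E¹` is an `s`-section if `s` restricted to `U` is a homeomorphism onto its image. -/
def IsSSection (s : G → V) (U : Set G) : Prop := Topology.IsEmbedding (U.restrict s)

/-- A complex-valued function is nonnegative if all its values are nonnegative reals. -/
def NonnegFn {α : Type*} (x : α → ℂ) : Prop := ∀ a, 0 ≤ x a

/-- The norm `‖x‖_{C₀(E⁰)} = sup_v √(Σ_{s e = v} |x e|²)` on `C_c(E¹)`. -/
def gnorm (s : G → V) (x : G → ℂ) : ℝ :=
  ⨆ v : V, Real.sqrt (∑' e : (s ⁻¹' {v} : Set G), ‖x (e : G)‖ ^ 2)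

variable {B : Type*} [NonUnitalCStarAlgebra B]

/-- A Toeplitz representation of the topological graph `(V, G, r, s)` in the C*-algebra `B`. -/
structure IsToeplitzRep (r s : G → V) (ψ : C_c(G, ℂ) →ₗ[ℂ] B)
    (π : C₀(V, ℂ) →⋆ₙₐ[ℂ] B) : Prop where
  act : ∀ (f : C₀(V, ℂ)) (x y : C_c(G, ℂ)), (∀ e, y e = f (r e) * x e) → ψ y = π f * ψ x
  inner : ∀ (x : C_c(G, ℂ)) (U : Set G), IsOpen U → IsSSection s U → tsupport ⇑x ⊆ U →
    ∀ g : C₀(V, ℂ), (∀ e, x e ≠ 0 → g (s e) = (‖x e‖ : ℂ) ^ 2) →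
      (∀ v, v ∉ s '' Function.support ⇑x → g v = 0) → π g = star (ψ x) * ψ x
  orth : ∀ (x y : C_c(G, ℂ)) (Ux Uy : Set G), IsOpen Ux → IsOpen Uy →
    IsSSection s Ux → IsSSection s Uy → Disjoint Ux Uy →
    tsupport ⇑x ⊆ Ux → tsupport ⇑y ⊆ Uy → star (ψ x) * ψ y = 0

/-- Covariance of a Toeplitz representation.  Here, for each `f` in the generating family `𝒢`,
the function `gN N` plays the role of `√(f_N)`, so that `f_N = (gN N)^2`. -/
def IsCovariant (r s : G → V) (ψ : C_c(G, ℂ) →ₗ[ℂ] B) (π : C₀(V, ℂ) →⋆ₙₐ[ℂ] B) : Prop :=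
  ∃ 𝒢 : Set C₀(V, ℂ),
    (∀ f ∈ 𝒢, HasCompactSupport ⇑f ∧ NonnegFn ⇑f ∧ tsupport ⇑f ⊆ Erg r) ∧
    closure ((NonUnitalStarAlgebra.adjoin ℂ 𝒢 : NonUnitalStarSubalgebra ℂ C₀(V, ℂ)) :
        Set C₀(V, ℂ)) = {f : C₀(V, ℂ) | ∀ v ∉ Erg r, f v = 0} ∧
    ∀ f ∈ 𝒢, ∃ (𝒩 : Finset (Set G)) (gN : Set G → C_c(G, ℂ)),
      (∀ N ∈ 𝒩, IsOpen N ∧ IsSSection s N) ∧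
      r ⁻¹' tsupport ⇑f ⊆ ⋃ N ∈ 𝒩, N ∧
      (∀ N ∈ 𝒩, NonnegFn ⇑(gN N) ∧
        Function.support ⇑(gN N) ⊆ N ∩ r ⁻¹' tsupport ⇑f) ∧
      (∀ e, ∑ N ∈ 𝒩, (gN N e) ^ 2 = f (r e)) ∧
      π f = ∑ N ∈ 𝒩, ψ (gN N) * star (ψ (gN N))

/-- A local `r`-fibration `(𝒰, W)`. -/
structure IsLocalRFib (r s : G → V) (𝒰 : Finset (Set G)) (W : Set V) : Prop where
  disj : (𝒰 : Set (Set G)).Pairwise Disjoint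
  sSec : ∀ U ∈ 𝒰, IsSSection s U
  rSec : ∀ U ∈ 𝒰, IsSSection r U
  pre : r ⁻¹' W = ⋃ U ∈ 𝒰, U
  ran : ∀ U ∈ 𝒰, r '' U = W

/-- An open local `r`-fibration. -/
def IsOpenLocalRFib (r s : G → V) (𝒰 : Finset (Set G)) (W : Set V) : Prop :=
  IsLocalRFib r s 𝒰 W ∧ IsOpen W ∧ ∀ U ∈ 𝒰, IsOpen U

/-- A precompact local `r`-fibration. -/
def IsPrecompactLocalRFib (r s : G → V) (𝒰 : Finset (Set G)) (W : Set V) : Prop :=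
  IsLocalRFib r s 𝒰 W ∧ IsCompact (closure W) ∧ ∀ U ∈ 𝒰, IsCompact (closure U)


variable {V G : Type*} [TopologicalSpace V] [TopologicalSpace G]

/-- The space `Eⁿ` of paths of length `n`, as a subset of `(E¹)ⁿ`. -/
def PathSet (r s : G → V) (n : ℕ) : Set (Fin n → G) :=
  {μ | ∀ (i : ℕ) (h : i + 1 < n), s (μ ⟨i, by omega⟩) = r (μ ⟨i + 1, h⟩)}

/-- The function `x₁ ◇ ⋯ ◇ xₙ` on `(E¹)ⁿ`. -/
def diam {n : ℕ} (x : Fin n → C_c(G, ℂ)) (μ : Fin n → G) : ℂ := ∏ i, x i (μ i)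

/-- `lprod a [b₁,…,bₖ] = a * b₁ * ⋯ * bₖ` (products in a possibly non-unital ring). -/
def lprod {M : Type*} [Mul M] : M → List M → M
  | a, [] => a
  | a, b :: l => lprod (a * b) l

/-- The product `F 0 * F 1 * ⋯ * F (n-1)` for `n ≥ 1`. -/
def finProd {M : Type*} [Mul M] {n : ℕ} (hn : 0 < n) (F : Fin n → M) : M :=
  lprod (F ⟨0, hn⟩) (List.ofFn fun i : Fin (n - 1) => F ⟨(i : ℕ) + 1, by omega⟩)

/-- The infinite path space `E^∞`. -/
def InfPath (r s : G → V) : Type _ := {z : ℕ → G // ∀ i, s (z i) = r (z (i + 1))}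

instance (r s : G → V) : TopologicalSpace (InfPath r s) :=
  inferInstanceAs (TopologicalSpace {z : ℕ → G // ∀ i, s (z i) = r (z (i + 1))})

/-- The shift map `σ : E^∞ → E^∞`. -/
def shift (r s : G → V) : InfPath r s → InfPath r s :=
  fun z => ⟨fun i => z.1 (i + 1), fun i => z.2 (i + 1)⟩

/-- A list of edges is a (finite) path when consecutive edges compose. -/
def IsPathL (r s : G → V) (μ : List G) : Prop := μ.Chain' fun e f => s e = r f

/-- The cylinder set `Z(μ)` of a finite path `μ` of positive length. -/
def cylP (r s : G → V) (μ : List G) : Set (InfPath r s) :=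
  {z | ∀ (i : ℕ) (h : i < μ.length), z.1 i = μ.get ⟨i, h⟩}

/-- The cylinder set `Z(v)` of a vertex `v`. -/
def cylV (r s : G → V) (v : V) : Set (InfPath r s) := {z | r (z.1 0) = v}

/-- `t_μ`, with the convention `t_v = q_v` for paths `μ` of length zero based at `v`. -/
def tPath {M : Type*} [Mul M] (Q : V → M) (T : G → M) (v : V) : List G → M
  | [] => Q v
  | e :: l => lprod (T e) (l.map T)

variable {B : Type*} [NonUnitalCStarAlgebra B]

/-- A Cuntz–Krieger `E`-family in `B`. -/
structure IsCKFamily (r s : G → V) (Q : V → B) (T : G → B) : Prop where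
  proj : ∀ v, star (Q v) = Q v ∧ Q v * Q v = Q v
  orth : ∀ v w, v ≠ w → Q v * Q w = 0
  srce : ∀ e, star (T e) * T e = Q (s e)
  ck : ∀ (v : V) (F : Finset G), (∀ e, e ∈ F ↔ r e = v) → Q v = ∑ e ∈ F, T e * star (T e)


/-- The product of a continuous function and a compactly supported one. -/
def cmulCc {G : Type*} [TopologicalSpace G] (h : C(G, ℂ)) (x : C_c(G, ℂ)) : C_c(G, ℂ) where
  toFun e := h e * x e
  continuous_toFun := h.continuous.mul x.continuous
  hasCompactSupport' := x.hasCompactSupport.mul_left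

@[simp] lemma cmulCc_apply {G : Type*} [TopologicalSpace G] (h : C(G, ℂ)) (x : C_c(G, ℂ))
    (e : G) : cmulCc h x e = h e * x e := rfl

lemma tsupport_cmulCc_left {G : Type*} [TopologicalSpace G] (h : C(G, ℂ)) (x : C_c(G, ℂ)) :
    tsupport ⇑(cmulCc h x) ⊆ tsupport ⇑h :=
  closure_mono fun _ he => left_ne_zero_of_mul he

lemma tsupport_cmulCc_right {G : Type*} [TopologicalSpace G] (h : C(G, ℂ)) (x : C_c(G, ℂ)) :
    tsupport ⇑(cmulCc h x) ⊆ tsupport ⇑x :=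
  closure_mono fun _ he => right_ne_zero_of_mul he

lemma IsSSection.mono {V G : Type*} [TopologicalSpace V] [TopologicalSpace G] {s : G → V}
    {N M : Set G} (hN : IsSSection s N) (hM : M ⊆ N) : IsSSection s M :=
  Topology.IsEmbedding.comp (g := N.domRestrict s) hN (Topology.IsEmbedding.inclusion hM)

/-- Every point of the domain of a local homeomorphism lies in an open section. -/
lemma exists_open_sSection {V G : Type*} [TopologicalSpace V] [TopologicalSpace G] {s : G → V}
    (hs : IsLocalHomeomorph s) (e : G) : ∃ U : Set G, IsOpen U ∧ IsSSection s U ∧ e ∈ U := by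
  obtain ⟨φ, he, rfl⟩ := hs e
  exact ⟨φ.source, φ.open_source, φ.isOpenEmbedding_restrict.isEmbedding, he⟩

/-- A function supported in an open `s`-section `N` can be transported to a function on the
vertex space along `s`. -/
lemma exists_pushforward {V G : Type*} [TopologicalSpace V] [TopologicalSpace G] [T2Space V]
    {s : G → V} (hs : IsLocalHomeomorph s) {N : Set G} (hNo : IsOpen N) (hN : IsSSection s N)
    (w : C_c(G, ℂ)) (hw : tsupport ⇑w ⊆ N) :
    ∃ k : C₀(V, ℂ), (∀ e ∈ N, k (s e) = w e) ∧ ∀ v ∉ s '' N, k v = 0 := by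
  have ho : Topology.IsOpenEmbedding (N.domRestrict s) :=
    ⟨hN, by rw [Set.range_domRestrict]; exact hs.isOpenMap _ hNo⟩
  let k : V → ℂ := Function.extend (N.domRestrict s) (fun e => w e) 0
  have k1 : ∀ e ∈ N, k (s e) = w e := fun e he =>
    hN.injective.extend_apply (fun e : N => w e) 0 ⟨e, he⟩
  have k2 : ∀ v ∉ s '' N, k v = 0 := fun v hv =>
    Function.extend_apply' _ _ _ fun ⟨e, he⟩ => hv ⟨e, e.2, he⟩
  have hK : IsCompact (s '' tsupport ⇑w) := w.hasCompactSupport.isCompact.image hs.continuous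
  have hsub : Function.support k ⊆ s '' tsupport ⇑w := by
    intro v hv
    by_cases hvN : v ∈ s '' N
    · obtain ⟨e, he, rfl⟩ := hvN
      rw [Function.mem_support, k1 e he] at hv
      exact ⟨e, subset_tsupport _ hv, rfl⟩
    · exact absurd (k2 v hvN) hv
  have hts : tsupport k ⊆ s '' tsupport ⇑w := closure_minimal hsub hK.isClosed
  have hc : Continuous k := by
    refine continuous_of_tsupport fun v hv => ?_
    obtain ⟨e, he, rfl⟩ := hts hv
    have := ho.continuousAt_iff (f := N.domRestrict s) (g := k) (x := ⟨e, hw he⟩)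
    refine this.1 ?_
    have h2 : k ∘ N.domRestrict s = fun e : N => w e := funext fun e => k1 e e.2
    rw [h2]
    exact (w.continuous.comp continuous_subtype_val).continuousAt
  have hcs : HasCompactSupport k := hK.of_isClosed_subset (isClosed_tsupport _) hts
  exact ⟨⟨⟨k, hc⟩, hcs.is_zero_at_infty⟩, k1, k2⟩

/-- A continuous function `h` with values in `ℝ`, viewed as complex valued. -/
def ofRealC {G : Type*} [TopologicalSpace G] (h : C(G, ℝ)) : C(G, ℂ) :=
  ⟨fun e => (h e : ℂ), Complex.continuous_ofReal.comp h.continuous⟩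

@[simp] lemma ofRealC_apply {G : Type*} [TopologicalSpace G] (h : C(G, ℝ)) (e : G) :
    ofRealC h e = (h e : ℂ) := rfl

lemma tsupport_ofRealC {G : Type*} [TopologicalSpace G] (h : C(G, ℝ)) :
    tsupport ⇑(ofRealC h) = tsupport ⇑h := by
  have : Function.support ⇑(ofRealC h) = Function.support ⇑h := by
    ext e; simp
  rw [tsupport, tsupport, this]

/-- A partition of unity on a compact set, subordinate to open `s`-sections. -/
lemma exists_partition {V G : Type*} [TopologicalSpace V] [TopologicalSpace G]
    [LocallyCompactSpace G] [T2Space G] {s : G → V} (hs : IsLocalHomeomorph s)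
    {K : Set G} (hK : IsCompact K) :
    ∃ (n : ℕ) (U : Fin n → Set G) (h : Fin n → C(G, ℂ)),
      (∀ i, IsOpen (U i) ∧ IsSSection s (U i) ∧ tsupport ⇑(h i) ⊆ U i) ∧
      (∀ i e, ‖h i e‖ ≤ 1) ∧ ∀ e ∈ K, ∑ i, h i e = 1 := by
  choose U hUo hU hmem using exists_open_sSection hs
  obtain ⟨t, ht⟩ := hK.elim_finite_subcover U hUo fun e _ => Set.mem_iUnion.2 ⟨e, hmem e⟩
  obtain ⟨h, h1, h2, h3, -⟩ := exists_continuous_sum_one_of_isOpen_isCompact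
    (s := fun i : Fin t.card => U (t.equivFin.symm i)) (fun i => hUo _) hK (by
      intro e he
      obtain ⟨a, ha, hea⟩ := Set.mem_iUnion₂.1 (ht he)
      exact Set.mem_iUnion.2 ⟨t.equivFin ⟨a, ha⟩, by simpa using hea⟩)
  refine ⟨t.card, fun i => U (t.equivFin.symm i), fun i => ofRealC (h i),
    fun i => ⟨hUo _, hU _, ?_⟩, fun i e => ?_, fun e he => ?_⟩
  · rw [tsupport_ofRealC]; exact h1 i
  · rw [ofRealC_apply, Complex.norm_real, Real.norm_eq_abs, abs_of_nonneg (h3 i e).1]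
    exact (h3 i e).2
  · have := h2 he
    simp only [Finset.sum_apply, Pi.one_apply] at this
    simp only [ofRealC_apply]
    exact_mod_cast this

/-- Decomposition of a compactly supported function along a partition of unity. -/
lemma sum_cmulCc {G : Type*} [TopologicalSpace G] {n : ℕ} (h : Fin n → C(G, ℂ)) (x : C_c(G, ℂ))
    (hx : ∀ e ∈ tsupport ⇑x, ∑ i, h i e = 1) : x = ∑ i, cmulCc (h i) x := by
  ext e
  rw [CompactlySupportedContinuousMap.sum_apply]
  simp only [cmulCc_apply]
  rw [← Finset.sum_mul]
  by_cases he : x e = 0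
  · simp [he]
  · rw [hx e (subset_tsupport _ he), one_mul]

section Rep

variable {V G : Type*} [TopologicalSpace V] [TopologicalSpace G]
  {r s : G → V} {B : Type*} [NonUnitalCStarAlgebra B]
  {ψ : C_c(G, ℂ) →ₗ[ℂ] B} {π : C₀(V, ℂ) →⋆ₙₐ[ℂ] B}

/-- The inner product relation for a single function. -/
lemma IsToeplitzRep.star_map_mul_self (hT : IsToeplitzRep r s ψ π)
    {N : Set G} (hNo : IsOpen N) (hN : IsSSection s N) {x : C_c(G, ℂ)} (hx : tsupport ⇑x ⊆ N)
    {k : C₀(V, ℂ)} (hk : ∀ e ∈ N, k (s e) = star (x e) * x e)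
    (hk' : ∀ v ∉ s '' N, k v = 0) : star (ψ x) * ψ x = π k := by
  refine (hT.inner x N hNo hN hx k (fun e he => ?_) fun v hv => ?_).symm
  · rw [hk e (hx (subset_tsupport _ he)), Complex.star_def, Complex.conj_mul']
  · by_cases h : v ∈ s '' N
    · obtain ⟨e, he, rfl⟩ := h
      have : x e = 0 := by
        by_contra h0
        exact hv ⟨e, h0, rfl⟩
      rw [hk e he, this, mul_zero]
    · exact hk' v h

/-- Functions with disjoint supports, one of which lies in a section, are orthogonal. -/
lemma IsToeplitzRep.orth_of_disjoint [LocallyCompactSpace G] [T2Space G]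
    (hT : IsToeplitzRep r s ψ π) (hs : IsLocalHomeomorph s)
    {N : Set G} (hNo : IsOpen N) (hN : IsSSection s N) {x z : C_c(G, ℂ)}
    (hx : tsupport ⇑x ⊆ N) (hd : Disjoint (tsupport ⇑x) (tsupport ⇑z)) :
    star (ψ x) * ψ z = 0 := by
  obtain ⟨A, C, hA, hC, hxA, hzC, hAC⟩ :=
    SeparatedNhds.of_isCompact_isCompact x.hasCompactSupport.isCompact
      z.hasCompactSupport.isCompact hd
  obtain ⟨n, U, h, hU, -, h1⟩ := exists_partition hs z.hasCompactSupport.isCompact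
  rw [sum_cmulCc h z h1, map_sum, Finset.mul_sum]
  refine Finset.sum_eq_zero fun i _ => ?_
  exact hT.orth x _ (N ∩ A) (U i ∩ C) (hNo.inter hA) ((hU i).1.inter hC)
    (hN.mono Set.inter_subset_left) ((hU i).2.1.mono Set.inter_subset_left)
    (hAC.mono Set.inter_subset_right Set.inter_subset_right) (Set.subset_inter hx hxA)
    (Set.subset_inter ((tsupport_cmulCc_left _ _).trans (hU i).2.2)
      ((tsupport_cmulCc_right _ _).trans hzC))

variable [T2Space V]

/-- The polarized inner product relation for functions supported in a common section. -/
lemma IsToeplitzRep.star_map_mul_map (hT : IsToeplitzRep r s ψ π) (hs : IsLocalHomeomorph s)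
    {N : Set G} (hNo : IsOpen N) (hN : IsSSection s N) {x y : C_c(G, ℂ)}
    (hx : tsupport ⇑x ⊆ N) (hy : tsupport ⇑y ⊆ N)
    {k : C₀(V, ℂ)} (hk : ∀ e ∈ N, k (s e) = star (x e) * y e)
    (hk' : ∀ v ∉ s '' N, k v = 0) : star (ψ x) * ψ y = π k := by
  have key : ∀ c : ℂ, ∃ kc : C₀(V, ℂ),
      (∀ e ∈ N, kc (s e) = star (x e + c * y e) * (x e + c * y e)) ∧ (∀ v ∉ s '' N, kc v = 0) ∧
      star (ψ x + c • ψ y) * (ψ x + c • ψ y) = π kc := by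
    intro c
    have hsup : tsupport ⇑(x + c • y) ⊆ N := by
      refine (tsupport_add ⇑x ⇑(c • y)).trans (Set.union_subset hx ?_)
      exact (closure_mono fun e he => right_ne_zero_of_mul (a := c) he).trans hy
    let w : C_c(G, ℂ) := cmulCc ⟨fun e => star ((x + c • y) e),
      ((x + c • y).continuous).star⟩ (x + c • y)
    obtain ⟨kc, h1, h2⟩ := exists_pushforward hs hNo hN w
      ((tsupport_cmulCc_right _ _).trans hsup)
    refine ⟨kc, fun e he => (h1 e he).trans rfl, h2, ?_⟩
    have := hT.star_map_mul_self hNo hN hsup (k := kc) (fun e he => (h1 e he).trans rfl) h2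
    rwa [map_add, map_smul] at this
  obtain ⟨k1, a1, b1, c1⟩ := key 1
  obtain ⟨k2, a2, b2, c2⟩ := key (-1)
  obtain ⟨k3, a3, b3, c3⟩ := key Complex.I
  obtain ⟨k4, a4, b4, c4⟩ := key (-Complex.I)
  have hk4 : (4 : ℂ) • k = k1 - k2 - Complex.I • k3 + Complex.I • k4 := by
    ext v
    simp only [ZeroAtInftyContinuousMap.coe_smul, ZeroAtInftyContinuousMap.coe_add,
      ZeroAtInftyContinuousMap.coe_sub, Pi.smul_apply, Pi.add_apply, Pi.sub_apply, smul_eq_mul]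
    by_cases h : v ∈ s '' N
    · obtain ⟨e, he, rfl⟩ := h
      rw [hk e he, a1 e he, a2 e he, a3 e he, a4 e he]
      simp only [star_add, star_mul', star_neg, star_one, Complex.star_def, Complex.conj_I]
      linear_combination
        (2 * starRingEnd ℂ (x e) * y e - 2 * starRingEnd ℂ (y e) * x e) * Complex.I_mul_I
    · simp [hk' v h, b1 v h, b2 v h, b3 v h, b4 v h]
  have h4 : (4 : ℂ) • (star (ψ x) * ψ y) = (4 : ℂ) • π k := by
    rw [← map_smul, hk4, map_add, map_sub, map_sub, map_smul, map_smul, ← c1, ← c2, ← c3, ← c4]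
    simp only [star_add, star_smul, add_mul, mul_add, smul_mul_assoc, mul_smul_comm, smul_add,
      smul_smul, star_neg, star_one, Complex.star_def, Complex.conj_I]
    match_scalars <;> simp <;> norm_num
  exact smul_right_injective B (four_ne_zero (α := ℂ)) h4

/-- Compatibility with the right action for functions supported in a section. -/
lemma IsToeplitzRep.mul_right (hT : IsToeplitzRep r s ψ π) (hs : IsLocalHomeomorph s)
    {N : Set G} (hNo : IsOpen N) (hN : IsSSection s N) {x y : C_c(G, ℂ)}
    (hx : tsupport ⇑x ⊆ N) (k : C₀(V, ℂ)) (hy : ∀ e, y e = x e * k (s e)) :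
    ψ y = ψ x * π k := by
  have hyN : tsupport ⇑y ⊆ N :=
    (closure_mono fun e he => left_ne_zero_of_mul (a := x e) (by rwa [← hy])).trans hx
  obtain ⟨m, hm, hm'⟩ := exists_pushforward hs hNo hN
    (cmulCc ⟨fun e => star (x e), x.continuous.star⟩ x) ((tsupport_cmulCc_right _ _).trans hx)
  replace hm : ∀ e ∈ N, m (s e) = star (x e) * x e := hm
  have hxx : star (ψ x) * ψ x = π m := hT.star_map_mul_map hs hNo hN hx hx hm hm'
  have hxy : star (ψ x) * ψ y = π (m * k) := hT.star_map_mul_map hs hNo hN hx hyN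
    (fun e he => by simp [hm e he, hy]; ring) fun v hv => by simp [hm' v hv]
  have hyx : star (ψ y) * ψ x = π (star k * m) := hT.star_map_mul_map hs hNo hN hyN hx
    (fun e he => by simp [hm e he, hy]; ring) fun v hv => by simp [hm' v hv]
  have hyy : star (ψ y) * ψ y = π (star k * m * k) := hT.star_map_mul_map hs hNo hN hyN hyN
    (fun e he => by simp [hm e he, hy]; ring) fun v hv => by simp [hm' v hv]
  rw [← sub_eq_zero, ← CStarRing.star_mul_self_eq_zero_iff]
  have : star (ψ y - ψ x * π k) * (ψ y - ψ x * π k)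
      = star (ψ y) * ψ y - star (ψ y) * ψ x * π k - star (π k) * (star (ψ x) * ψ y)
        + star (π k) * (star (ψ x) * ψ x) * π k := by
    rw [star_sub, star_mul]
    noncomm_ring
  rw [this, hxx, hxy, hyx, hyy, ← map_star, ← map_mul, ← map_mul, ← map_mul, ← map_mul,
    mul_assoc (star k) m k]
  abel

/-- The rank one operator associated with a function whose support lies in a section acts by
multiplication. -/
lemma IsToeplitzRep.rank_one_of_tsupport [LocallyCompactSpace G] [T2Space G]
    (hT : IsToeplitzRep r s ψ π) (hs : IsLocalHomeomorph s)
    {N : Set G} (hNo : IsOpen N) (hN : IsSSection s N) {x z y : C_c(G, ℂ)}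
    (hx : tsupport ⇑x ⊆ N) (hy : ∀ e, y e = x e * star (x e) * z e) :
    ψ x * (star (ψ x) * ψ z) = ψ y := by
  obtain ⟨K, hK, hxK, hKN⟩ := exists_compact_between x.hasCompactSupport.isCompact hNo hx
  obtain ⟨L, hL, hKL, hLN⟩ := exists_compact_between hK hNo hKN
  obtain ⟨χ, hχ1, hχ0, -, -⟩ := exists_continuous_one_zero_of_isCompact hK
    isOpen_interior.isClosed_compl (Set.disjoint_compl_right_iff_subset.2 hKL)
  let z₁ := cmulCc (ofRealC χ) z
  have hz₁ : tsupport ⇑z₁ ⊆ N := by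
    refine (tsupport_cmulCc_left _ _).trans ?_
    rw [tsupport_ofRealC]
    refine (closure_minimal ?_ hL.isClosed).trans hLN
    intro e he
    by_contra hne
    exact he (hχ0 fun h => hne (interior_subset h))
  have hz₁x : ∀ e, x e * z₁ e = x e * z e := by
    intro e
    by_cases he : x e = 0
    · simp [he]
    · have : χ e = 1 := hχ1 (interior_subset (hxK (subset_tsupport _ he)))
      simp [z₁, this]
  have hz₂ : star (ψ x) * ψ (z - z₁) = 0 := by
    refine hT.orth_of_disjoint hs hNo hN hx ?_
    have h1 : Disjoint (interior K) (tsupport ⇑(z - z₁)) := by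
      refine Disjoint.closure_right ?_ isOpen_interior
      refine Set.disjoint_left.2 fun e he hne => hne ?_
      have : χ e = 1 := hχ1 (interior_subset he)
      simp [z₁, this]
    exact h1.mono_left hxK
  rw [map_sub, mul_sub, sub_eq_zero] at hz₂
  rw [hz₂]
  obtain ⟨k, hk, hk'⟩ := exists_pushforward hs hNo hN
    (cmulCc ⟨fun e => star (x e), x.continuous.star⟩ z₁) ((tsupport_cmulCc_right _ _).trans hz₁)
  replace hk : ∀ e ∈ N, k (s e) = star (x e) * z₁ e := hk
  rw [hT.star_map_mul_map hs hNo hN hx hz₁ hk hk']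
  refine (hT.mul_right hs hNo hN hx k fun e => ?_).symm
  by_cases he : x e = 0
  · simp [hy, he]
  · rw [hk e (hx (subset_tsupport _ he)), hy, mul_left_comm, hz₁x]
    ring

/-- A Toeplitz representation is bounded for the supremum norm on functions supported in a fixed
compact set. -/
lemma IsToeplitzRep.exists_bound [LocallyCompactSpace G] [T2Space G]
    (hT : IsToeplitzRep r s ψ π) (hs : IsLocalHomeomorph s) {K : Set G} (hK : IsCompact K) :
    ∃ C : ℝ, ∀ (x : C_c(G, ℂ)) (ε : ℝ), 0 ≤ ε → tsupport ⇑x ⊆ K → (∀ e, ‖x e‖ ≤ ε) →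
      ‖ψ x‖ ≤ C * ε := by
  obtain ⟨n, U, h, hU, hle, h1⟩ := exists_partition hs hK
  refine ⟨n, fun x ε hε hx hxε => ?_⟩
  have key : ∀ i, ‖ψ (cmulCc (h i) x)‖ ≤ ε := by
    intro i
    set y := cmulCc (h i) x with hydef
    have hyε : ∀ e, ‖y e‖ ≤ ε := fun e => by
      rw [hydef, cmulCc_apply, norm_mul]
      exact (mul_le_of_le_one_left (norm_nonneg _) (hle i e)).trans (hxε e)
    have hyU : tsupport ⇑y ⊆ U i := (tsupport_cmulCc_left _ _).trans (hU i).2.2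
    obtain ⟨k, hk, hk'⟩ := exists_pushforward hs (hU i).1 (hU i).2.1
      (cmulCc ⟨fun e => star (y e), y.continuous.star⟩ y) ((tsupport_cmulCc_right _ _).trans hyU)
    replace hk : ∀ e ∈ U i, k (s e) = star (y e) * y e := hk
    have hkn : ‖k‖ ≤ ε * ε := by
      rw [← ZeroAtInftyContinuousMap.norm_toBCF_eq_norm]
      refine (BoundedContinuousFunction.norm_le (by positivity)).2 fun v => ?_
      change ‖k v‖ ≤ ε * ε
      by_cases hv : v ∈ s '' U i
      · obtain ⟨e, he, rfl⟩ := hv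
        rw [hk e he, norm_mul, norm_star]
        exact mul_le_mul (hyε e) (hyε e) (norm_nonneg _) hε
      · rw [hk' v hv, norm_zero]
        positivity
    have hn : ‖ψ y‖ * ‖ψ y‖ ≤ ε * ε := by
      rw [← CStarRing.norm_star_mul_self, hT.star_map_mul_self (hU i).1 (hU i).2.1 hyU hk hk']
      exact (NonUnitalStarAlgHom.norm_apply_le π k).trans hkn
    exact (mul_self_le_mul_self_iff (norm_nonneg _) hε).2 hn
  rw [sum_cmulCc h x fun e he => h1 e (hx he), map_sum]
  refine (norm_sum_le _ _).trans ((Finset.sum_le_sum fun i _ => key i).trans ?_)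
  simp

/-- The rank one operator associated with a nonnegative function whose open support lies in a
section acts by multiplication. -/
lemma IsToeplitzRep.rank_one [LocallyCompactSpace G] [T2Space G]
    (hT : IsToeplitzRep r s ψ π) (hs : IsLocalHomeomorph s)
    {N : Set G} (hNo : IsOpen N) (hN : IsSSection s N) {x z y : C_c(G, ℂ)} (hpos : NonnegFn ⇑x)
    (hx : Function.support ⇑x ⊆ N) (hy : ∀ e, y e = x e ^ 2 * z e) :
    ψ x * (star (ψ x) * ψ z) = ψ y := by
  have hre : ∀ e, x e = ((x e).re : ℂ) := fun e =>
    Complex.ext rfl (by simpa using (Complex.le_def.1 (hpos e)).2.symm)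
  have hre0 : ∀ e, 0 ≤ (x e).re := fun e => (Complex.le_def.1 (hpos e)).1
  have hcre : Continuous fun e => (x e).re := Complex.continuous_re.comp x.continuous
  have hsub : ∀ ε : ℝ, 0 < ε → ∃ u : C_c(G, ℂ), tsupport ⇑u ⊆ N ∧ tsupport ⇑u ⊆ tsupport ⇑x ∧
      ∀ e, u e = ((max ((x e).re - ε) 0 : ℝ) : ℂ) := by
    intro ε hε
    have hc : Continuous fun e => ((max ((x e).re - ε) 0 : ℝ) : ℂ) := by fun_prop
    have hs1 : (Function.support fun e => ((max ((x e).re - ε) 0 : ℝ) : ℂ)) ⊆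
        {e | ε ≤ (x e).re} := by
      intro e he
      by_contra hlt
      simp only [Set.mem_ofPred_eq, not_le] at hlt
      exact he (by simp [max_eq_right (sub_nonpos.2 hlt.le)])
    have hs2 : {e | ε ≤ (x e).re} ⊆ Function.support ⇑x := by
      intro e he h0
      simp only [Set.mem_ofPred_eq, h0, Complex.zero_re] at he
      exact absurd he (not_le.2 hε)
    have hcl : IsClosed {e | ε ≤ (x e).re} := isClosed_le continuous_const hcre
    have hs3 := closure_minimal hs1 hcl
    exact ⟨⟨⟨_, hc⟩, x.hasCompactSupport.isCompact.of_isClosed_subset (isClosed_tsupport _)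
      (hs3.trans (hs2.trans (subset_tsupport _)))⟩, hs3.trans (hs2.trans hx),
      hs3.trans (hs2.trans (subset_tsupport _)), fun e => rfl⟩
  choose u huN hux hu using fun n : ℕ => hsub (1 / ((n : ℝ) + 1)) (by positivity)
  have hdiff : ∀ n e, ‖u n e - x e‖ ≤ 1 / ((n : ℝ) + 1) := by
    intro n e
    have h0 : (0 : ℝ) < 1 / ((n : ℝ) + 1) := by positivity
    rw [hu n e, hre e, ← Complex.ofReal_sub, Complex.norm_real, Real.norm_eq_abs,
      Complex.ofReal_re, abs_le]
    have := hre0 e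
    constructor
    · linarith [le_max_left ((x e).re - 1 / ((n : ℝ) + 1)) 0]
    · have : max ((x e).re - 1 / ((n : ℝ) + 1)) 0 ≤ (x e).re := max_le (by linarith) this
      linarith
  have hlim0 : Filter.Tendsto (fun n : ℕ => 1 / ((n : ℝ) + 1)) Filter.atTop (nhds 0) :=
    tendsto_one_div_add_atTop_nhds_zero_nat
  obtain ⟨C, hC⟩ := hT.exists_bound hs x.hasCompactSupport.isCompact
  have hψ : Filter.Tendsto (fun n => ψ (u n)) Filter.atTop (nhds (ψ x)) := by
    rw [tendsto_iff_norm_sub_tendsto_zero]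
    refine squeeze_zero (fun _ => norm_nonneg _) (fun n => ?_)
      (mul_zero C ▸ hlim0.const_mul C)
    rw [← map_sub]
    exact hC _ _ (by positivity)
      ((tsupport_sub ⇑(u n) ⇑x).trans (Set.union_subset (hux n) subset_rfl)) (hdiff n)
  let w : ℕ → C_c(G, ℂ) := fun n => cmulCc ⟨fun e => u n e * star (u n e),
    (u n).continuous.mul (u n).continuous.star⟩ z
  obtain ⟨D, hD⟩ := hT.exists_bound hs z.hasCompactSupport.isCompact
  obtain ⟨M, hM⟩ : ∃ M : ℝ, ∀ e, ‖x e‖ ≤ M :=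
    x.hasCompactSupport.exists_bound_of_continuous x.continuous
  obtain ⟨L, hL⟩ : ∃ L : ℝ, ∀ e, ‖z e‖ ≤ L :=
    z.hasCompactSupport.exists_bound_of_continuous z.continuous
  have hyz : tsupport ⇑y ⊆ tsupport ⇑z :=
    closure_mono fun e he => right_ne_zero_of_mul (a := x e ^ 2) (by rwa [← hy])
  have hψw : Filter.Tendsto (fun n => ψ (w n)) Filter.atTop (nhds (ψ y)) := by
    by_cases hG : Nonempty G
    · obtain ⟨e₀⟩ := hG
      have hM0 : 0 ≤ M := (norm_nonneg _).trans (hM e₀)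
      have hL0 : 0 ≤ L := (norm_nonneg _).trans (hL e₀)
      rw [tendsto_iff_norm_sub_tendsto_zero]
      refine squeeze_zero (fun _ => norm_nonneg _) (fun n => ?_)
        (by simpa only [zero_mul, mul_zero] using
          (hlim0.mul_const ((2 * M + 1) * L)).const_mul D)
      rw [← map_sub]
      refine hD _ _ (by positivity) ((tsupport_sub ⇑(w n) ⇑y).trans
        (Set.union_subset (tsupport_cmulCc_right _ _) hyz)) fun e => ?_
      have hreal : star (u n e) = u n e := by rw [hu]; exact Complex.conj_ofReal _
      have heq : (w n - y) e = (u n e - x e) * ((u n e - x e + 2 * x e) * z e) := by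
        change u n e * star (u n e) * z e - y e = _
        rw [hreal, hy]
        ring
      rw [heq, norm_mul, norm_mul]
      have hd := hdiff n e
      have h1 : 1 / ((n : ℝ) + 1) ≤ 1 := by
        rw [div_le_one (by positivity)]
        linarith [n.cast_nonneg (α := ℝ)]
      have h2 : ‖u n e - x e + 2 * x e‖ ≤ 2 * M + 1 := by
        refine (norm_add_le _ _).trans ?_
        rw [norm_mul, Complex.norm_two]
        linarith [hM e]
      have h3 := hL e
      gcongr
    · have : y = 0 := by
        ext e
        exact absurd ⟨e⟩ hG
      have hw : ∀ n, w n = 0 := fun n => by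
        ext e
        exact absurd ⟨e⟩ hG
      simp [this, hw]
  refine tendsto_nhds_unique (hψ.mul (hψ.star.mul_const (ψ z))) ?_
  refine hψw.congr fun n => ?_
  exact (hT.rank_one_of_tsupport hs hNo hN (huN n) fun e => rfl).symm

/-- A finite sum of rank one operators decomposing `f ∘ r` acts on the range of `ψ` as `π f`. -/
lemma IsToeplitzRep.sum_rank_one_mul [LocallyCompactSpace G] [T2Space G]
    (hT : IsToeplitzRep r s ψ π) (hr : Continuous r) (hs : IsLocalHomeomorph s) (f : C₀(V, ℂ))
    (𝒩 : Finset (Set G)) (h𝒩 : ∀ N ∈ 𝒩, IsOpen N ∧ IsSSection s N) (gN : Set G → C_c(G, ℂ))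
    (hgN : ∀ N ∈ 𝒩, NonnegFn ⇑(gN N) ∧ Function.support ⇑(gN N) ⊆ N)
    (hsum : ∀ e : G, ∑ N ∈ 𝒩, (gN N e) ^ 2 = f (r e)) (z : C_c(G, ℂ)) :
    (∑ N ∈ 𝒩, ψ (gN N) * star (ψ (gN N))) * ψ z = π f * ψ z := by
  rw [← hT.act f z (cmulCc ⟨fun e => f (r e), f.continuous.comp hr⟩ z) fun e => rfl,
    Finset.sum_mul]
  have : cmulCc ⟨fun e => f (r e), f.continuous.comp hr⟩ z =
      ∑ N ∈ 𝒩, cmulCc ⟨fun e => gN N e ^ 2, (gN N).continuous.pow 2⟩ z := by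
    ext e
    rw [CompactlySupportedContinuousMap.sum_apply]
    simp only [cmulCc_apply, ContinuousMap.coe_mk]
    rw [← Finset.sum_mul, hsum]
  rw [this, map_sum]
  refine Finset.sum_congr rfl fun N hN => ?_
  rw [mul_assoc]
  exact hT.rank_one hs (h𝒩 N hN).1 (h𝒩 N hN).2 (hgN N hN).1 (hgN N hN).2 fun e => rfl

end Rep

/-- An element annihilating the image of a set of self-adjoint elements annihilates the image of
the C*-algebra it generates. -/
lemma mul_map_eq_zero_of_mem_closure_adjoin {A B : Type*} [NonUnitalCStarAlgebra A]
    [NonUnitalCStarAlgebra B] (π : A →⋆ₙₐ[ℂ] B) {S : Set A} (hS : ∀ a ∈ S, star a = a) {d : B}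
    (hd : ∀ a ∈ S, d * π a = 0) {a : A}
    (ha : a ∈ closure ((NonUnitalStarAlgebra.adjoin ℂ S : NonUnitalStarSubalgebra ℂ A) : Set A)) :
    d * π a = 0 := by
  have hcont : Continuous fun a : A => d * π a :=
    continuous_const.mul (AddMonoidHomClass.continuous_of_bound π 1 fun a => by
      simpa using NonUnitalStarAlgHom.norm_apply_le π a)
  refine closure_minimal ?_ (isClosed_singleton.preimage hcont) ha
  intro b hb
  suffices h : d * π b = 0 ∧ d * π (star b) = 0 from h.1
  induction hb using NonUnitalStarAlgebra.adjoin_induction with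
  | mem x hx => exact ⟨hd x hx, by rw [hS x hx]; exact hd x hx⟩
  | add x y _ _ hx hy => simp [mul_add, hx.1, hx.2, hy.1, hy.2]
  | zero => simp
  | mul x y _ _ hx hy => simp only [star_mul, map_mul, ← mul_assoc, hx.1, hy.2, zero_mul, and_self]
  | smul c x _ hx => simp only [star_smul, map_smul, mul_smul_comm, hx.1, hx.2, smul_zero, and_self]
  | star x _ hx => exact ⟨hx.2, by rw [star_star]; exact hx.1⟩

/-- If `(ψ, π)` is a covariant Toeplitz representation of `E`, then the
covariance relation `π(f) = Σ_N ψ(√f_N) ψ(√f_N)*` holds for *every* nonnegative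
`f ∈ C_c(E⁰_rg)`, every finite cover `𝒩` of `r⁻¹(supp f)` by open `s`-sections and every
subordinate decomposition `Σ_N f_N = f ∘ r`.  (Here `gN N` plays the role of `√(f_N)`, so
`f_N = (gN N)²`.) -/
theorem statement6 {V G : Type*} [TopologicalSpace V] [TopologicalSpace G]
    [LocallyCompactSpace V] [T2Space V] [LocallyCompactSpace G] [T2Space G]
    (r s : G → V) (hr : Continuous r) (hs : IsLocalHomeomorph s)
    {B : Type*} [NonUnitalCStarAlgebra B]
    (ψ : C_c(G, ℂ) →ₗ[ℂ] B) (π : C₀(V, ℂ) →⋆ₙₐ[ℂ] B)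
    (hT : IsToeplitzRep r s ψ π) (hCov : IsCovariant r s ψ π)
    (f : C₀(V, ℂ)) (hfc : HasCompactSupport ⇑f) (hfpos : NonnegFn ⇑f)
    (hfsupp : tsupport ⇑f ⊆ Erg r)
    (𝒩 : Finset (Set G)) (h𝒩 : ∀ N ∈ 𝒩, IsOpen N ∧ IsSSection s N)
    (hcover : r ⁻¹' tsupport ⇑f ⊆ ⋃ N ∈ 𝒩, N)
    (gN : Set G → C_c(G, ℂ))
    (hgN : ∀ N ∈ 𝒩, NonnegFn ⇑(gN N) ∧
      Function.support ⇑(gN N) ⊆ N ∩ r ⁻¹' tsupport ⇑f)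
    (hsum : ∀ e : G, ∑ N ∈ 𝒩, (gN N e) ^ 2 = f (r e)) :
    π f = ∑ N ∈ 𝒩, ψ (gN N) * star (ψ (gN N)) := by
  have hT' := hT.sum_rank_one_mul hr hs f 𝒩 h𝒩 gN
    (fun N hN => ⟨(hgN N hN).1, (hgN N hN).2.trans Set.inter_subset_left⟩) hsum
  set T := ∑ N ∈ 𝒩, ψ (gN N) * star (ψ (gN N)) with hTdef
  have hD : ∀ z, (π f - T) * ψ z = 0 := fun z => by rw [sub_mul, hT' z, sub_self]
  have hDsum : ∀ (𝒮 : Finset (Set G)) (g : Set G → C_c(G, ℂ)),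
      (π f - T) * ∑ N ∈ 𝒮, ψ (g N) * star (ψ (g N)) = 0 := fun 𝒮 g => by
    rw [Finset.mul_sum]
    exact Finset.sum_eq_zero fun N _ => by rw [← mul_assoc, hD, zero_mul]
  have hstar : ∀ h : C₀(V, ℂ), NonnegFn ⇑h → star h = h := fun h hh => by
    ext v
    exact Complex.conj_eq_iff_im.2 (Complex.le_def.1 (hh v)).2.symm
  have hTstar : star T = T := by
    simp [hTdef, star_sum, star_mul]
  obtain ⟨𝒢, h𝒢, hgen, hcov⟩ := hCov
  have hDf : (π f - T) * π f = 0 := by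
    refine mul_map_eq_zero_of_mem_closure_adjoin π (fun g hg => hstar g (h𝒢 g hg).2.1)
      (fun g hg => ?_) (S := 𝒢) ?_
    · obtain ⟨𝒮, g', -, -, -, -, hπ⟩ := hcov g hg
      rw [hπ]
      exact hDsum 𝒮 g'
    · rw [hgen]
      intro v hv
      by_contra hne
      exact hv (hfsupp (subset_tsupport _ hne))
  rw [← sub_eq_zero, ← CStarRing.mul_star_self_eq_zero_iff, star_sub, hTstar, ← map_star,
    hstar f hfpos, mul_sub, hDf, hDsum 𝒩 gN, sub_zero]

end TopGraphPaper
end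
end

section
/- Let E be a topological graph, let ℬ be an open base for the topology on E¹ consisting of s-sections, and let ℱ ⊆ C_c(E¹) be a collection of nonnegative functions such that osupp(x) is an s-section for every x ∈ ℱ; assume that for each U ∈ ℬ, the linear span of {x ∈ ℱ : osupp(x) ⊆ U} is dense in C₀(U) in the supremum norm. Let B be a C*-algebra, let ψ₀ : span(ℱ) → B be a linear map, and let π : C₀(E⁰) → B be a *-homomorphism such that π((√(xy))^) = ψ₀(x)* ψ₀(y) for all x, y ∈ ℱ, where xy denotes the pointwise product (which is nonnegative with osupp(xy) an s-section, so that the hat function (√(xy))^ is defined). Then ‖ψ₀(y)‖ ≤ ‖y‖_{C₀(E⁰)} for all y ∈ span(ℱ), and ψ₀ extends uniquely to a linear map ψ : C_c(E¹) → B satisfying ‖ψ(x)‖ ≤ ‖x‖_{C₀(E⁰)} for all x ∈ C_c(E¹). If moreover there is a subset 𝒢 ⊆ C₀(E⁰) generating C₀(E⁰) as a C*-algebra such that ψ(f·x) = π(f)ψ₀(x) for all f ∈ 𝒢 and x ∈ ℱ, then (ψ, π) is a Toeplitz representation of E. -/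
open scoped ZeroAtInfty CompactlySupported ComplexOrder

noncomputable section

namespace TopGraphPaper

variable {V G : Type*} [TopologicalSpace V] [TopologicalSpace G]

variable {B : Type*} [NonUnitalCStarAlgebra B]

variable {V G : Type*} [TopologicalSpace V] [TopologicalSpace G]

variable {B : Type*} [NonUnitalCStarAlgebra B]

section SeminormExtension

variable {E F : Type*} [AddCommGroup E] [Module ℂ E] [NormedAddCommGroup F] [NormedSpace ℂ F]

lemma linearMap_eq_zero_of_seminorm_dense (p : Seminorm ℂ E) {S : Submodule ℂ E}
    (hS : ∀ x, ∀ ε > (0 : ℝ), ∃ y ∈ S, p (x - y) ≤ ε) (T : E →ₗ[ℂ] F) (C : ℝ)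
    (hT : ∀ x, ‖T x‖ ≤ C * p x) (hTS : ∀ y ∈ S, T y = 0) (x : E) : T x = 0 := by
  rw [← norm_le_zero_iff]
  refine le_of_forall_pos_le_add fun δ hδ => ?_
  obtain ⟨y, hy, hxy⟩ := hS x (δ / (|C| + 1)) (by positivity)
  calc ‖T x‖ = ‖T (x - y)‖ := by rw [map_sub, hTS y hy, sub_zero]
    _ ≤ C * p (x - y) := hT _
    _ ≤ (|C| + 1) * (δ / (|C| + 1)) := by
        gcongr
        exact (le_abs_self C).trans (by linarith)
    _ = 0 + δ := by field_simp; simp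

lemma exists_seminorm_bounded_extension [CompleteSpace F] (p : Seminorm ℂ E) {S : Submodule ℂ E}
    (hS : ∀ x, ∀ ε > (0 : ℝ), ∃ y ∈ S, p (x - y) ≤ ε) (f : S →ₗ[ℂ] F)
    (hf : ∀ y : S, ‖f y‖ ≤ p y) :
    ∃ T : E →ₗ[ℂ] F, (∀ y : S, T y = f y) ∧ ∀ x, ‖T x‖ ≤ p x := by
  let : SeminormedAddCommGroup E := p.toAddGroupSeminorm.toSeminormedAddCommGroup
  let : NormedSpace ℂ E := ⟨fun a x => (map_smul_eq_mul p a x).le⟩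
  have hdense : DenseRange S.subtype := by
    intro x
    rw [Metric.mem_closure_iff]
    intro ε hε
    obtain ⟨y, hy, hxy⟩ := hS x (ε / 2) (by positivity)
    refine ⟨y, ⟨⟨y, hy⟩, rfl⟩, ?_⟩
    rw [dist_eq_norm]
    exact lt_of_le_of_lt hxy (by linarith)
  have hbound : ∀ y : S, ‖f y‖ ≤ 1 * ‖S.subtype y‖ := fun y => by
    rw [one_mul]
    exact hf y
  refine ⟨(f.extendOfNorm S.subtype).toLinearMap, fun y => ?_, fun x => ?_⟩
  · exact LinearMap.extendOfNorm_eq hdense ⟨1, hbound⟩ y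
  · have := LinearMap.norm_extendOfNorm_apply_le hdense 1 hbound x
    rw [one_mul] at this
    exact this

end SeminormExtension

section EdgeModule

variable {r s : G → V}

lemma gnorm_nonneg {X Y : Type*} (s : Y → X) (x : Y → ℂ) : 0 ≤ gnorm s x :=
  Real.iSup_nonneg fun _ => Real.sqrt_nonneg _

lemma gnorm_le {X Y : Type*} {s : Y → X} {x : Y → ℂ} {C : ℝ} (hC : 0 ≤ C)
    (h : ∀ v, Real.sqrt (∑' e : (s ⁻¹' {v} : Set Y), ‖x (e : Y)‖ ^ 2) ≤ C) : gnorm s x ≤ C :=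
  Real.iSup_le h hC

lemma gnorm_le_of_injOn {X Y : Type*} {s : Y → X} {U : Set Y}
    (hU : Set.InjOn s U) {x : Y → ℂ} (hx : ∀ e ∉ U, x e = 0) {C : ℝ} (hC : 0 ≤ C)
    (h : ∀ e, ‖x e‖ ≤ C) : gnorm s x ≤ C := by
  refine gnorm_le hC fun v => Real.sqrt_le_iff.2 ⟨hC, ?_⟩
  by_cases hv : ∃ e : (s ⁻¹' {v} : Set Y), (e : Y) ∈ U
  · obtain ⟨e, he⟩ := hv
    rw [tsum_eq_single e fun e' he' => ?_]
    · gcongr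
      exact h e
    · rw [hx e' fun he'U => he' (Subtype.ext (hU he'U he (e'.2.trans e.2.symm)))]
      simp
  · push Not at hv
    simp only [hx _ (hv _), norm_zero]
    simpa using sq_nonneg C

lemma gnorm_smul {X : Type*} {s : G → X} (c : ℂ) (x : C_c(G, ℂ)) : gnorm s ⇑(c • x) = ‖c‖ * gnorm s x := by
  rw [gnorm, gnorm, Real.mul_iSup_of_nonneg (norm_nonneg c)]
  refine iSup_congr fun v => ?_
  simp only [CompactlySupportedContinuousMap.smul_apply, norm_smul, mul_pow]
  rw [tsum_mul_left, Real.sqrt_mul (sq_nonneg _), Real.sqrt_sq (norm_nonneg _)]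

lemma zeroAtInfty_norm_le {f : C₀(V, ℂ)} {C : ℝ} (hC : 0 ≤ C) (h : ∀ v, ‖f v‖ ≤ C) : ‖f‖ ≤ C := by
  rw [← ZeroAtInftyContinuousMap.norm_toBCF_eq_norm]
  exact (BoundedContinuousFunction.norm_le hC).2 h

lemma zeroAtInfty_norm_coe_le (f : C₀(V, ℂ)) (v : V) : ‖f v‖ ≤ ‖f‖ := by
  rw [← ZeroAtInftyContinuousMap.norm_toBCF_eq_norm]
  exact f.toBCF.norm_coe_le_norm v

/-- The left action of `f ∈ C₀(E⁰)` on `C_c(E¹)`. -/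
def leftMul (hr : Continuous r) (f : C₀(V, ℂ)) : C_c(G, ℂ) →ₗ[ℂ] C_c(G, ℂ) where
  toFun x := (⟨fun e => f (r e), f.continuous.comp hr⟩ : C(G, ℂ)) • x
  map_add' x y := by ext e; exact mul_add _ _ _
  map_smul' c x := by ext e; exact mul_left_comm _ _ _

lemma leftMul_apply (hr : Continuous r) (f : C₀(V, ℂ)) (x : C_c(G, ℂ)) (e : G) :
    leftMul hr f x e = f (r e) * x e := rfl

lemma eq_zero_of_mem_span_support_subset {ℱ : Set C_c(G, ℂ)} {U : Set G} {y : C_c(G, ℂ)}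
    (hy : y ∈ Submodule.span ℂ {x ∈ ℱ | Function.support ⇑x ⊆ U}) {e : G} (he : e ∉ U) :
    y e = 0 := by
  induction hy using Submodule.span_induction with
  | mem x hx => exact Function.notMem_support.1 fun h => he (hx.2 h)
  | zero => rfl
  | add x y _ _ hx hy => rw [CompactlySupportedContinuousMap.add_apply, hx, hy, add_zero]
  | smul c x _ hx => rw [CompactlySupportedContinuousMap.smul_apply, hx, smul_zero]

lemma mem_addSubmonoid_closure_of_open_cover [T2Space G] [LocallyCompactSpace G]
    {𝒰 : Set (Set G)} (hopen : ∀ U ∈ 𝒰, IsOpen U) (hcover : ∀ e, ∃ U ∈ 𝒰, e ∈ U)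
    (x : C_c(G, ℂ)) :
    x ∈ AddSubmonoid.closure {y : C_c(G, ℂ) | ∃ U ∈ 𝒰, tsupport ⇑y ⊆ U} := by
  obtain ⟨t, ht⟩ := x.hasCompactSupport.isCompact.elim_finite_subcover
    (fun U : 𝒰 => (U : Set G)) (fun U => hopen U U.2) (fun e _ => by
      obtain ⟨U, hU, he⟩ := hcover e
      exact Set.mem_iUnion.2 ⟨⟨U, hU⟩, he⟩)
  obtain ⟨f, hfs, hf1, -, -⟩ := exists_continuous_sum_one_of_isOpen_isCompact
    (s := fun i => ((t.equivFin.symm i : 𝒰) : Set G)) (fun i => hopen _ (Subtype.coe_prop _))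
    x.hasCompactSupport.isCompact (fun e he => by
      obtain ⟨U, hU, heU⟩ := Set.mem_iUnion₂.1 (ht he)
      exact Set.mem_iUnion.2 ⟨t.equivFin ⟨U, hU⟩, by simpa using heU⟩)
  have hx : x = ∑ i, f i • x := by
    ext e
    rw [CompactlySupportedContinuousMap.sum_apply]
    simp only [CompactlySupportedContinuousMap.smulc_apply]
    rw [← Finset.sum_smul]
    by_cases he : e ∈ tsupport ⇑x
    · have := hf1 he
      simp only [Finset.sum_apply, Pi.one_apply] at this
      rw [this, one_smul]
    · rw [image_eq_zero_of_notMem_tsupport he, smul_zero]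
  rw [hx]
  exact sum_mem fun i _ => AddSubmonoid.subset_closure
    ⟨_, Subtype.coe_prop _, (tsupport_smul_subset_left (f i) x).trans (hfs i)⟩

lemma finite_fiber_inter_support [T1Space V] (hs : IsLocalHomeomorph s) (x : C_c(G, ℂ)) (v : V) :
    {e : (s ⁻¹' {v} : Set G) | x (e : G) ≠ 0}.Finite := by
  have hcpt : IsCompact (tsupport ⇑x ∩ s ⁻¹' {v}) :=
    x.hasCompactSupport.isCompact.inter_right (isClosed_singleton.preimage hs.continuous)
  have hdisc : IsDiscrete (tsupport ⇑x ∩ s ⁻¹' {v}) := by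
    refine hs.isLocalHomeomorphOn.isDiscrete_of_image (Set.Subsingleton.isDiscrete ?_)
    rintro _ ⟨e, he, rfl⟩ _ ⟨e', he', rfl⟩
    exact he.2.trans he'.2.symm
  refine Set.Finite.of_finite_image ((hcpt.finite hdisc).subset ?_)
    Subtype.val_injective.injOn
  rintro _ ⟨e, he, rfl⟩
  exact ⟨subset_tsupport _ he, e.2⟩

lemma summable_fiber [T1Space V] (hs : IsLocalHomeomorph s) (x : C_c(G, ℂ)) (v : V)
    {M : Type*} [AddCommMonoid M] [TopologicalSpace M] (f : G → M)
    (hf : ∀ e, x e = 0 → f e = 0) : Summable fun e : (s ⁻¹' {v} : Set G) => f e := by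
  refine summable_of_hasFiniteSupport ((finite_fiber_inter_support hs x v).subset fun e he hxe => ?_)
  exact he (hf _ hxe)

lemma summable_norm_sq [T1Space V] (hs : IsLocalHomeomorph s) (x : C_c(G, ℂ)) (v : V) :
    Summable fun e : (s ⁻¹' {v} : Set G) => ‖x (e : G)‖ ^ 2 :=
  summable_fiber hs x v (fun e => ‖x e‖ ^ 2) fun e he => by simp [he]

/-- Summing over the fibers of a local homeomorphism sends functions with small compact support
to continuous functions vanishing at infinity. -/
lemma exists_fiberSum_of_tsupport_subset_source [T2Space V] (φ : OpenPartialHomeomorph G V)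
    (x : C_c(G, ℂ)) (hx : tsupport ⇑x ⊆ φ.source) :
    ∃ g : C₀(V, ℂ), ∀ v, g v = ∑' e : (φ ⁻¹' {v} : Set G), x e := by
  classical
  set g : V → ℂ := fun v => if v ∈ φ.target then x (φ.symm v) else 0 with hg
  have hK : IsCompact (φ '' tsupport ⇑x) :=
    x.hasCompactSupport.isCompact.image_of_continuousOn (φ.continuousOn.mono hx)
  have hg0 : ∀ v ∉ φ '' tsupport ⇑x, g v = 0 := by
    intro v hv
    by_cases hvt : v ∈ φ.target
    · simp only [hg, if_pos hvt]
      refine image_eq_zero_of_notMem_tsupport fun h => hv ⟨_, h, φ.right_inv hvt⟩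
    · simp only [hg, if_neg hvt]
  have hcont : Continuous g := by
    rw [continuous_iff_continuousAt]
    intro v
    by_cases hvt : v ∈ φ.target
    · have h1 : ContinuousAt (fun w => x (φ.symm w)) v :=
        x.continuous.continuousAt.comp (φ.continuousAt_symm hvt)
      refine h1.congr ?_
      filter_upwards [φ.open_target.mem_nhds hvt] with w hw
      simp only [hg, if_pos hw]
    · have hv : v ∉ φ '' tsupport ⇑x := by
        rintro ⟨e, he, rfl⟩
        exact hvt (φ.map_source (hx he))
      refine (continuousAt_const (y := (0 : ℂ))).congr ?_
      filter_upwards [hK.isClosed.isOpen_compl.mem_nhds hv] with w hw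
      exact (hg0 w hw).symm
  let gc : C_c(V, ℂ) := ⟨⟨g, hcont⟩, HasCompactSupport.intro hK hg0⟩
  refine ⟨(gc : C₀(V, ℂ)), fun v => ?_⟩
  change g v = _
  by_cases hvt : v ∈ φ.target
  · rw [tsum_eq_single (⟨φ.symm v, φ.right_inv hvt⟩ : (φ ⁻¹' {v} : Set G))]
    · simp only [hg, if_pos hvt]
    · intro e he
      by_contra hxe
      refine he (Subtype.ext ?_)
      have h1 : (e : G) ∈ φ.source := hx (subset_tsupport _ hxe)
      have h2 : φ e = v := e.2
      exact (φ.left_inv h1).symm.trans (congrArg φ.symm h2)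
  · rw [tsum_congr (g := fun _ => (0 : ℂ)), tsum_zero]
    · simp only [hg, if_neg hvt]
    · intro e
      by_contra hxe
      have h1 : (e : G) ∈ φ.source := hx (subset_tsupport _ hxe)
      have h2 : φ e = v := e.2
      exact hvt (h2 ▸ φ.map_source h1)

variable [T2Space V] [T2Space G] [LocallyCompactSpace G]

lemma exists_fiberSum (hs : IsLocalHomeomorph s) (x : C_c(G, ℂ)) :
    ∃ g : C₀(V, ℂ), ∀ v, g v = ∑' e : (s ⁻¹' {v} : Set G), x e := by
  have hmem := mem_addSubmonoid_closure_of_open_cover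
    (𝒰 := {U | ∃ φ : OpenPartialHomeomorph G V, s = φ ∧ φ.source = U})
    (by rintro _ ⟨φ, -, rfl⟩; exact φ.open_source)
    (fun e => by
      obtain ⟨φ, he, hφ⟩ := hs e
      exact ⟨_, ⟨φ, hφ, rfl⟩, he⟩) x
  induction hmem using AddSubmonoid.closure_induction with
  | mem y hy =>
    obtain ⟨_, ⟨φ, rfl, rfl⟩, hy⟩ := hy
    exact exists_fiberSum_of_tsupport_subset_source φ y hy
  | zero => exact ⟨0, fun v => by simp⟩
  | add y z _ _ hy hz =>
    obtain ⟨g, hg⟩ := hy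
    obtain ⟨h, hh⟩ := hz
    refine ⟨g + h, fun v => ?_⟩
    rw [ZeroAtInftyContinuousMap.add_apply, hg, hh,
      ← (summable_fiber hs y v y fun _ h => h).tsum_add (summable_fiber hs z v z fun _ h => h)]
    rfl

/-- The map `C_c(E¹) → C₀(E⁰)` summing a function over the fibers of `s`. -/
def fiberSum (hs : IsLocalHomeomorph s) : C_c(G, ℂ) →ₗ[ℂ] C₀(V, ℂ) where
  toFun x := (exists_fiberSum hs x).choose
  map_add' x y := by
    ext v
    rw [ZeroAtInftyContinuousMap.add_apply, (exists_fiberSum hs _).choose_spec,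
      (exists_fiberSum hs x).choose_spec, (exists_fiberSum hs y).choose_spec,
      ← (summable_fiber hs x v x fun _ h => h).tsum_add (summable_fiber hs y v y fun _ h => h)]
    rfl
  map_smul' c x := by
    ext v
    rw [ZeroAtInftyContinuousMap.smul_apply, (exists_fiberSum hs _).choose_spec,
      (exists_fiberSum hs x).choose_spec, RingHom.id_apply, smul_eq_mul, ← tsum_mul_left]
    rfl

lemma fiberSum_apply (hs : IsLocalHomeomorph s) (x : C_c(G, ℂ)) (v : V) :
    fiberSum hs x v = ∑' e : (s ⁻¹' {v} : Set G), x e :=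
  (exists_fiberSum hs x).choose_spec v

/-- The `C₀(E⁰)`-valued inner product on `C_c(E¹)`. -/
def edgeInner (hs : IsLocalHomeomorph s) (x y : C_c(G, ℂ)) : C₀(V, ℂ) :=
  fiberSum hs (star x * y)

lemma edgeInner_apply (hs : IsLocalHomeomorph s) (x y : C_c(G, ℂ)) (v : V) :
    edgeInner hs x y v = ∑' e : (s ⁻¹' {v} : Set G), star (x e) * y e :=
  fiberSum_apply hs _ v

lemma edgeInner_add_right (hs : IsLocalHomeomorph s) (x y z : C_c(G, ℂ)) :
    edgeInner hs x (y + z) = edgeInner hs x y + edgeInner hs x z := by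
  rw [edgeInner, mul_add, map_add]; rfl

lemma edgeInner_smul_right (hs : IsLocalHomeomorph s) (c : ℂ) (x y : C_c(G, ℂ)) :
    edgeInner hs x (c • y) = c • edgeInner hs x y := by
  rw [edgeInner, mul_smul_comm, map_smul]; rfl

lemma star_edgeInner (hs : IsLocalHomeomorph s) (x y : C_c(G, ℂ)) :
    star (edgeInner hs x y) = edgeInner hs y x := by
  ext v
  rw [ZeroAtInftyContinuousMap.star_apply, edgeInner_apply, edgeInner_apply, tsum_star]
  refine tsum_congr fun e => ?_
  rw [star_mul, star_star]

/-- The inner product with a fixed first argument, as a linear map. -/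
def edgeInnerLeft (hs : IsLocalHomeomorph s) (x : C_c(G, ℂ)) : C_c(G, ℂ) →ₗ[ℂ] C₀(V, ℂ) where
  toFun := edgeInner hs x
  map_add' := edgeInner_add_right hs x
  map_smul' c := edgeInner_smul_right hs c x

lemma edgeInner_self_apply (hs : IsLocalHomeomorph s) (x : C_c(G, ℂ)) (v : V) :
    edgeInner hs x x v = ((∑' e : (s ⁻¹' {v} : Set G), ‖x (e : G)‖ ^ 2 : ℝ) : ℂ) := by
  rw [edgeInner_apply, Complex.ofReal_tsum]
  refine tsum_congr fun e => ?_
  rw [Complex.star_def, Complex.conj_mul']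
  push_cast
  rfl

lemma norm_edgeInner_self_apply (hs : IsLocalHomeomorph s) (x : C_c(G, ℂ)) (v : V) :
    ‖edgeInner hs x x v‖ = ∑' e : (s ⁻¹' {v} : Set G), ‖x (e : G)‖ ^ 2 := by
  rw [edgeInner_self_apply, Complex.norm_real, Real.norm_of_nonneg]
  exact tsum_nonneg fun e => by positivity

lemma sqrt_fiber_le_gnorm (hs : IsLocalHomeomorph s) (x : C_c(G, ℂ)) (v : V) :
    Real.sqrt (∑' e : (s ⁻¹' {v} : Set G), ‖x (e : G)‖ ^ 2) ≤ gnorm s x := by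
  refine le_ciSup (f := fun v => Real.sqrt (∑' e : (s ⁻¹' {v} : Set G), ‖x (e : G)‖ ^ 2))
    ⟨Real.sqrt ‖edgeInner hs x x‖, ?_⟩ v
  rintro _ ⟨w, rfl⟩
  refine Real.sqrt_le_sqrt ?_
  rw [← norm_edgeInner_self_apply hs]
  exact zeroAtInfty_norm_coe_le _ _

lemma gnorm_sq (hs : IsLocalHomeomorph s) (x : C_c(G, ℂ)) :
    gnorm s x ^ 2 = ‖edgeInner hs x x‖ := by
  refine le_antisymm ?_ (zeroAtInfty_norm_le (sq_nonneg _) fun v => ?_)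
  · rw [← Real.le_sqrt (gnorm_nonneg s x) (norm_nonneg _)]
    refine gnorm_le (Real.sqrt_nonneg _) fun v => Real.sqrt_le_sqrt ?_
    rw [← norm_edgeInner_self_apply hs]
    exact zeroAtInfty_norm_coe_le _ _
  · rw [norm_edgeInner_self_apply, ← Real.sqrt_le_left (gnorm_nonneg s x)]
    exact sqrt_fiber_le_gnorm hs x v

lemma gnorm_add_le (hs : IsLocalHomeomorph s) (x y : C_c(G, ℂ)) :
    gnorm s ⇑(x + y) ≤ gnorm s x + gnorm s y := by
  refine gnorm_le (add_nonneg (gnorm_nonneg _ _) (gnorm_nonneg _ _)) fun v => ?_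
  have hx := summable_norm_sq hs x v
  have hy := summable_norm_sq hs y v
  have hxy := Real.Lp_add_le_tsum_of_nonneg (p := 2)
    (f := fun e : (s ⁻¹' {v} : Set G) => ‖x (e : G)‖)
    (g := fun e : (s ⁻¹' {v} : Set G) => ‖y (e : G)‖) (by norm_num)
    (fun _ => norm_nonneg _) (fun _ => norm_nonneg _)
    (by simpa only [Real.rpow_two] using hx) (by simpa only [Real.rpow_two] using hy)
  simp only [Real.rpow_two, ← Real.sqrt_eq_rpow] at hxy
  refine le_trans (Real.sqrt_le_sqrt ?_) (hxy.2.trans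
    (add_le_add (sqrt_fiber_le_gnorm hs x v) (sqrt_fiber_le_gnorm hs y v)))
  refine (summable_norm_sq hs (x + y) v).tsum_le_tsum (fun e => ?_) hxy.1
  gcongr
  exact norm_add_le _ _

/-- The norm of `C_c(E¹)` as a seminorm. -/
def gnormSeminorm (hs : IsLocalHomeomorph s) : Seminorm ℂ C_c(G, ℂ) :=
  Seminorm.of (fun x => gnorm s x) (gnorm_add_le hs) gnorm_smul

lemma norm_edgeInner_le (hs : IsLocalHomeomorph s) (x y : C_c(G, ℂ)) :
    ‖edgeInner hs x y‖ ≤ gnorm s x * gnorm s y := by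
  refine zeroAtInfty_norm_le (mul_nonneg (gnorm_nonneg _ _) (gnorm_nonneg _ _)) fun v => ?_
  have hx := summable_norm_sq hs x v
  have hy := summable_norm_sq hs y v
  have hxy := Real.inner_le_Lp_mul_Lq_tsum_of_nonneg (p := 2) (q := 2)
    (f := fun e : (s ⁻¹' {v} : Set G) => ‖x (e : G)‖)
    (g := fun e : (s ⁻¹' {v} : Set G) => ‖y (e : G)‖) Real.HolderConjugate.two_two
    (fun _ => norm_nonneg _) (fun _ => norm_nonneg _)
    (by simpa only [Real.rpow_two] using hx) (by simpa only [Real.rpow_two] using hy)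
  simp only [Real.rpow_two, ← Real.sqrt_eq_rpow] at hxy
  rw [edgeInner_apply]
  have hn : ∀ e : (s ⁻¹' {v} : Set G), ‖star (x e) * y e‖ = ‖x (e : G)‖ * ‖y (e : G)‖ :=
    fun e => by rw [norm_mul, norm_star]
  calc ‖∑' e : (s ⁻¹' {v} : Set G), star (x e) * y e‖
      ≤ ∑' e : (s ⁻¹' {v} : Set G), ‖star (x e) * y e‖ :=
        norm_tsum_le_tsum_norm
          (summable_fiber hs x v (fun e => ‖star (x e) * y e‖) fun e he => by simp [he])
    _ = ∑' e : (s ⁻¹' {v} : Set G), ‖x (e : G)‖ * ‖y (e : G)‖ := tsum_congr hn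
    _ ≤ _ := hxy
    _ ≤ _ := mul_le_mul (sqrt_fiber_le_gnorm hs x v) (sqrt_fiber_le_gnorm hs y v)
        (Real.sqrt_nonneg _) (gnorm_nonneg _ _)

lemma gnorm_leftMul_le (hs : IsLocalHomeomorph s) (hr : Continuous r) (f : C₀(V, ℂ))
    (x : C_c(G, ℂ)) : gnorm s (leftMul hr f x) ≤ ‖f‖ * gnorm s x := by
  refine gnorm_le (mul_nonneg (norm_nonneg _) (gnorm_nonneg _ _)) fun v => ?_
  refine le_trans ?_ (mul_le_mul_of_nonneg_left (sqrt_fiber_le_gnorm hs x v) (norm_nonneg f))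
  conv_rhs => rw [← Real.sqrt_sq (norm_nonneg f)]
  rw [← Real.sqrt_mul (sq_nonneg _), ← tsum_mul_left]
  refine Real.sqrt_le_sqrt ((summable_norm_sq hs (leftMul hr f x) v).tsum_le_tsum (fun e => ?_)
    ((summable_norm_sq hs x v).mul_left _))
  rw [leftMul_apply, norm_mul, mul_pow]
  gcongr
  exact zeroAtInfty_norm_coe_le _ _

lemma edgeInner_leftMul (hs : IsLocalHomeomorph s) (hr : Continuous r) (f : C₀(V, ℂ))
    (x y : C_c(G, ℂ)) :
    edgeInner hs (leftMul hr f x) y = edgeInner hs x (leftMul hr (star f) y) := by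
  ext v
  rw [edgeInner_apply, edgeInner_apply]
  refine tsum_congr fun e => ?_
  rw [leftMul_apply, leftMul_apply, star_mul, ZeroAtInftyContinuousMap.star_apply, mul_assoc]

lemma exists_mem_span_gnorm_sub_le (hs : IsLocalHomeomorph s) {ℬ : Set (Set G)}
    (hbasis : TopologicalSpace.IsTopologicalBasis ℬ) (hBinj : ∀ U ∈ ℬ, Set.InjOn s U)
    {ℱ : Set C_c(G, ℂ)}
    (hdense : ∀ U ∈ ℬ, ∀ g : C₀(G, ℂ), (∀ e ∉ U, g e = 0) → ∀ ε > (0 : ℝ),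
      ∃ y ∈ Submodule.span ℂ {x ∈ ℱ | Function.support ⇑x ⊆ U}, ∀ e, ‖g e - y e‖ ≤ ε)
    (x : C_c(G, ℂ)) : ∀ ε > (0 : ℝ), ∃ y ∈ Submodule.span ℂ ℱ, gnorm s ⇑(x - y) ≤ ε := by
  have hmem := mem_addSubmonoid_closure_of_open_cover (fun U hU => hbasis.isOpen hU)
    (fun e => by simpa using hbasis.exists_subset_of_mem_open (Set.mem_univ e) isOpen_univ) x
  induction hmem using AddSubmonoid.closure_induction with
  | mem x hx =>
    obtain ⟨U, hU, hxU⟩ := hx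
    intro ε hε
    have hx0 : ∀ e ∉ U, x e = 0 := fun e he =>
      image_eq_zero_of_notMem_tsupport fun h => he (hxU h)
    obtain ⟨y, hy, hxy⟩ := hdense U hU (x : C₀(G, ℂ)) hx0 ε hε
    refine ⟨y, Submodule.span_mono (Set.sep_subset _ _) hy,
      gnorm_le_of_injOn (hBinj U hU) (fun e he => ?_) hε.le hxy⟩
    rw [CompactlySupportedContinuousMap.sub_apply, hx0 e he,
      eq_zero_of_mem_span_support_subset hy he, sub_zero]
  | zero =>
    intro ε hε
    exact ⟨0, zero_mem _, by
      rw [sub_zero]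
      exact (map_zero (gnormSeminorm hs)).trans_le hε.le⟩
  | add x x' _ _ hx hx' =>
    intro ε hε
    obtain ⟨y, hy, hxy⟩ := hx (ε / 2) (half_pos hε)
    obtain ⟨y', hy', hxy'⟩ := hx' (ε / 2) (half_pos hε)
    refine ⟨y + y', add_mem hy hy', ?_⟩
    rw [add_sub_add_comm]
    exact (gnorm_add_le hs _ _).trans (by linarith)

lemma edgeInner_apply_of_injOn_left (hs : IsLocalHomeomorph s) {x y : C_c(G, ℂ)}
    (hx : Set.InjOn s (Function.support ⇑x)) {e : G} (he : x e ≠ 0) :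
    edgeInner hs x y (s e) = star (x e) * y e := by
  rw [edgeInner_apply, tsum_eq_single (⟨e, rfl⟩ : (s ⁻¹' {s e} : Set G)) fun e' he' => ?_]
  by_cases hxe' : x (e' : G) = 0
  · rw [hxe', star_zero, zero_mul]
  · have hse : s (e' : G) = s e := e'.2
    exact absurd (Subtype.ext (hx (Function.mem_support.2 hxe') (Function.mem_support.2 he) hse)) he'

lemma edgeInner_apply_eq_zero (hs : IsLocalHomeomorph s) {x y : C_c(G, ℂ)} {v : V}
    (h : ∀ e, s e = v → x e * y e = 0) : edgeInner hs x y v = 0 := by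
  rw [edgeInner_apply, tsum_congr (g := fun _ => (0 : ℂ)) fun e => ?_, tsum_zero]
  rcases mul_eq_zero.1 (h e e.2) with h | h <;> simp [h]

section Representation

variable {S : Submodule ℂ C_c(G, ℂ)} {π : C₀(V, ℂ) →⋆ₙₐ[ℂ] B}

lemma map_edgeInner_of_mem_span (hs : IsLocalHomeomorph s) {ℱ : Set C_c(G, ℂ)}
    (ψ₀ : Submodule.span ℂ ℱ →ₗ[ℂ] B)
    (h : ∀ x (hx : x ∈ ℱ) y (hy : y ∈ ℱ), π (edgeInner hs x y) =
      star (ψ₀ ⟨x, Submodule.subset_span hx⟩) * ψ₀ ⟨y, Submodule.subset_span hy⟩)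
    (x y : Submodule.span ℂ ℱ) : π (edgeInner hs x y) = star (ψ₀ x) * ψ₀ y := by
  have key : ∀ x : Submodule.span ℂ ℱ,
      (∀ y (hy : y ∈ ℱ), π (edgeInner hs x y) =
        star (ψ₀ x) * ψ₀ ⟨y, Submodule.subset_span hy⟩) →
      ∀ y : Submodule.span ℂ ℱ, π (edgeInner hs x y) = star (ψ₀ x) * ψ₀ y := by
    rintro x hx ⟨y, hy⟩
    induction hy using Submodule.span_induction with
    | mem y hy => exact hx y hy
    | zero =>
      have h0 : ψ₀ ⟨0, zero_mem _⟩ = 0 := map_zero ψ₀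
      rw [h0, mul_zero]
      exact (congrArg π (map_zero (edgeInnerLeft hs x.1))).trans (map_zero π)
    | add y z hy hz hy' hz' =>
      have hadd : ψ₀ ⟨y + z, add_mem hy hz⟩ = ψ₀ ⟨y, hy⟩ + ψ₀ ⟨z, hz⟩ :=
        map_add ψ₀ ⟨y, hy⟩ ⟨z, hz⟩
      rw [hadd, mul_add, ← hy', ← hz', edgeInner_add_right, map_add]
    | smul c y hy hy' =>
      have hsmul : ψ₀ ⟨c • y, Submodule.smul_mem _ c hy⟩ = c • ψ₀ ⟨y, hy⟩ :=
        map_smul ψ₀ c ⟨y, hy⟩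
      rw [hsmul, mul_smul_comm, ← hy', edgeInner_smul_right, map_smul]
  refine key x (fun y hy => ?_) y
  rw [← star_edgeInner, map_star, key ⟨y, Submodule.subset_span hy⟩ (h y hy) x, star_mul, star_star]

lemma norm_le_gnorm_of_map_edgeInner_self (hs : IsLocalHomeomorph s) {x : C_c(G, ℂ)} {b : B}
    (h : π (edgeInner hs x x) = star b * b) : ‖b‖ ≤ gnorm s x := by
  refine le_of_sq_le_sq ?_ (gnorm_nonneg s x)
  rw [gnorm_sq hs, sq, ← CStarRing.norm_star_mul_self, ← h]
  exact NonUnitalStarAlgHom.norm_apply_le π _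

variable {ψ : C_c(G, ℂ) →ₗ[ℂ] B}

lemma map_edgeInner_of_dense (hs : IsLocalHomeomorph s)
    (hS : ∀ x, ∀ ε > (0 : ℝ), ∃ y ∈ S, gnorm s ⇑(x - y) ≤ ε)
    (hψ : ∀ x, ‖ψ x‖ ≤ gnorm s ⇑x)
    (h : ∀ x ∈ S, ∀ y ∈ S, π (edgeInner hs x y) = star (ψ x) * ψ y) (x y : C_c(G, ℂ)) :
    π (edgeInner hs x y) = star (ψ x) * ψ y := by
  have key : ∀ x : C_c(G, ℂ), (∀ y ∈ S, π (edgeInner hs x y) = star (ψ x) * ψ y) →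
      ∀ y, π (edgeInner hs x y) = star (ψ x) * ψ y := by
    intro x hx y
    refine sub_eq_zero.1 (linearMap_eq_zero_of_seminorm_dense (gnormSeminorm hs) hS
      ((π : C₀(V, ℂ) →ₗ[ℂ] B) ∘ₗ edgeInnerLeft hs x - LinearMap.mulLeft ℂ (star (ψ x)) ∘ₗ ψ)
      (gnorm s x + ‖ψ x‖) (fun y => ?_) (fun y hy => sub_eq_zero.2 (hx y hy)) y)
    rw [add_mul]
    refine (norm_sub_le _ _).trans (add_le_add ?_ ?_)
    · exact (NonUnitalStarAlgHom.norm_apply_le π _).trans (norm_edgeInner_le hs x y)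
    · refine (norm_mul_le _ _).trans ?_
      rw [norm_star]
      exact mul_le_mul_of_nonneg_left (hψ y) (norm_nonneg _)
  refine key x (fun y hy => ?_) y
  rw [← star_edgeInner, map_star, key y (h y hy) x, star_mul, star_star]

/-- If `ψ` intertwines multiplication by `f` with `π f`, then it intertwines multiplication by
`star f` with `π (star f)`. -/
lemma map_leftMul_star (hs : IsLocalHomeomorph s) (hr : Continuous r)
    (hinner : ∀ x y, π (edgeInner hs x y) = star (ψ x) * ψ y) {f : C₀(V, ℂ)}
    (hf : ∀ x, ψ (leftMul hr f x) = π f * ψ x) (x : C_c(G, ℂ)) :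
    ψ (leftMul hr (star f) x) = π (star f) * ψ x := by
  have horth : ∀ y, star (ψ y) * (ψ (leftMul hr (star f) x) - π (star f) * ψ x) = 0 := by
    intro y
    rw [mul_sub, ← hinner, ← edgeInner_leftMul, hinner, hf, star_mul, map_star, mul_assoc, sub_self]
  refine sub_eq_zero.1 ((CStarRing.star_mul_self_eq_zero_iff _).1 ?_)
  have hcomm : π f * π (star f) = π (star f) * π f := by rw [← map_mul, mul_comm, map_mul]
  have hzero : star (ψ x) * (π f * (ψ (leftMul hr (star f) x) - π (star f) * ψ x)) = 0 := by
    have hmul : leftMul hr f (leftMul hr (star f) x) = leftMul hr (star f) (leftMul hr f x) := by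
      ext e
      exact mul_left_comm _ _ _
    rw [mul_sub, ← hf, ← mul_assoc (π f), hcomm, mul_assoc (π (star f)), ← hf, hmul, mul_sub,
      ← hinner, ← edgeInner_leftMul, hinner, hf, star_mul, map_star, mul_assoc, sub_self]
  rw [star_sub, sub_mul, horth, star_mul, ← map_star π (star f), star_star, mul_assoc, hzero, sub_zero]

lemma map_leftMul_of_closure_adjoin_eq_univ (hs : IsLocalHomeomorph s) (hr : Continuous r)
    (hψ : ∀ x, ‖ψ x‖ ≤ gnorm s ⇑x)
    (hinner : ∀ x y, π (edgeInner hs x y) = star (ψ x) * ψ y) {𝒢 : Set C₀(V, ℂ)}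
    (h𝒢 : closure ((NonUnitalStarAlgebra.adjoin ℂ 𝒢 : NonUnitalStarSubalgebra ℂ C₀(V, ℂ)) :
      Set C₀(V, ℂ)) = Set.univ)
    (h : ∀ f ∈ 𝒢, ∀ x, ψ (leftMul hr f x) = π f * ψ x) (f : C₀(V, ℂ)) (x : C_c(G, ℂ)) :
    ψ (leftMul hr f x) = π f * ψ x := by
  have hadd : ∀ (f g : C₀(V, ℂ)) (x : C_c(G, ℂ)),
      leftMul hr (f + g) x = leftMul hr f x + leftMul hr g x := fun f g x => by
    ext e
    exact add_mul _ _ _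
  have hsmul : ∀ (c : ℂ) (f : C₀(V, ℂ)) (x : C_c(G, ℂ)),
      leftMul hr (c • f) x = c • leftMul hr f x := fun c f x => by
    ext e
    exact mul_assoc _ _ _
  have hadjoin : ∀ f ∈ NonUnitalStarAlgebra.adjoin ℂ 𝒢, ∀ x, ψ (leftMul hr f x) = π f * ψ x := by
    intro f hf
    induction hf using NonUnitalStarAlgebra.adjoin_induction with
    | mem f hf => exact h f hf
    | add f g _ _ hf hg => intro x; rw [hadd, map_add, hf, hg, map_add, add_mul]
    | zero =>
      intro x
      have : leftMul hr 0 x = 0 := by ext e; exact zero_mul _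
      rw [this, map_zero, map_zero, zero_mul]
    | mul f g _ _ hf hg =>
      intro x
      have : leftMul hr (f * g) x = leftMul hr f (leftMul hr g x) := by ext e; exact mul_assoc _ _ _
      rw [this, hf, hg, map_mul, mul_assoc]
    | smul c f _ hf => intro x; rw [hsmul, map_smul, hf, map_smul, smul_mul_assoc]
    | star f _ hf => exact map_leftMul_star hs hr hinner hf
  let T : C₀(V, ℂ) →ₗ[ℂ] B :=
    { toFun := fun f => ψ (leftMul hr f x) - π f * ψ x
      map_add' := fun f g => by rw [hadd, map_add, map_add, add_mul]; abel
      map_smul' := fun c f => by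
        rw [hsmul, map_smul, map_smul, smul_mul_assoc, RingHom.id_apply, smul_sub] }
  refine sub_eq_zero.1 (linearMap_eq_zero_of_seminorm_dense (normSeminorm ℂ C₀(V, ℂ))
    (S := (NonUnitalStarAlgebra.adjoin ℂ 𝒢).toNonUnitalSubalgebra.toSubmodule)
    (fun f ε hε => ?_) T (gnorm s x + ‖ψ x‖) (fun f => ?_)
    (fun f hf => sub_eq_zero.2 (hadjoin f hf x)) f)
  · obtain ⟨g, hg, hfg⟩ := Metric.mem_closure_iff.1 (h𝒢 ▸ Set.mem_univ f) ε hε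
    exact ⟨g, hg, (dist_eq_norm f g).symm.trans_le hfg.le⟩
  · rw [add_mul]
    refine (norm_sub_le _ _).trans (add_le_add ?_ ?_)
    · rw [mul_comm]
      exact (hψ _).trans (gnorm_leftMul_le hs hr f x)
    · rw [mul_comm]
      exact (norm_mul_le _ _).trans
        (mul_le_mul_of_nonneg_right (NonUnitalStarAlgHom.norm_apply_le π f) (norm_nonneg _))

end Representation

end EdgeModule

/-- A linear map `ψ₀` on the span of `ℱ` satisfying
`π((√(xy))^) = ψ₀(x)* ψ₀(y)` for `x, y ∈ ℱ` is bounded for `‖·‖_{C₀(E⁰)}` and extends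
uniquely to a bounded linear map `ψ : C_c(E¹) → B`; if moreover `ψ(f·x) = π(f) ψ₀(x)` for all
`f` in some generating subset `𝒢` of `C₀(E⁰)` and all `x ∈ ℱ`, then `(ψ, π)` is a Toeplitz
representation of `E`. -/
theorem statement13 {V G : Type*} [TopologicalSpace V] [TopologicalSpace G]
    [LocallyCompactSpace V] [T2Space V] [LocallyCompactSpace G] [T2Space G]
    (r s : G → V) (hr : Continuous r) (hs : IsLocalHomeomorph s)
    (ℬ : Set (Set G)) (hbasis : TopologicalSpace.IsTopologicalBasis ℬ)
    (hBsec : ∀ U ∈ ℬ, IsSSection s U)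
    (ℱ : Set C_c(G, ℂ))
    (hF : ∀ x ∈ ℱ, NonnegFn ⇑x ∧ IsSSection s (Function.support ⇑x))
    (hdense : ∀ U ∈ ℬ, ∀ g : C₀(G, ℂ), (∀ e ∉ U, g e = 0) → ∀ ε > (0 : ℝ),
      ∃ y ∈ Submodule.span ℂ {x ∈ ℱ | Function.support ⇑x ⊆ U}, ∀ e, ‖g e - y e‖ ≤ ε)
    {B : Type*} [NonUnitalCStarAlgebra B]
    (ψ₀ : (Submodule.span ℂ ℱ) →ₗ[ℂ] B) (π : C₀(V, ℂ) →⋆ₙₐ[ℂ] B)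
    (hmul : ∀ (x : C_c(G, ℂ)) (hx : x ∈ ℱ) (y : C_c(G, ℂ)) (hy : y ∈ ℱ),
      ∀ g : C₀(V, ℂ),
        (∀ e : G, x e * y e ≠ 0 → g (s e) = x e * y e) →
        (∀ v : V, v ∉ s '' Function.support (fun e => x e * y e) → g v = 0) →
        π g = star (ψ₀ ⟨x, Submodule.subset_span hx⟩) * ψ₀ ⟨y, Submodule.subset_span hy⟩) :
    (∀ y : Submodule.span ℂ ℱ, ‖ψ₀ y‖ ≤ gnorm s ⇑(y : C_c(G, ℂ))) ∧
    (∃! ψ : C_c(G, ℂ) →ₗ[ℂ] B,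
      (∀ y : Submodule.span ℂ ℱ, ψ (y : C_c(G, ℂ)) = ψ₀ y) ∧
      ∀ x : C_c(G, ℂ), ‖ψ x‖ ≤ gnorm s ⇑x) ∧
    (∀ ψ : C_c(G, ℂ) →ₗ[ℂ] B,
      (∀ y : Submodule.span ℂ ℱ, ψ (y : C_c(G, ℂ)) = ψ₀ y) →
      (∀ x : C_c(G, ℂ), ‖ψ x‖ ≤ gnorm s ⇑x) →
      ∀ 𝒢 : Set C₀(V, ℂ),
        closure ((NonUnitalStarAlgebra.adjoin ℂ 𝒢 : NonUnitalStarSubalgebra ℂ C₀(V, ℂ)) :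
          Set C₀(V, ℂ)) = Set.univ →
        (∀ f ∈ 𝒢, ∀ (x : C_c(G, ℂ)) (hx : x ∈ ℱ), ∀ y : C_c(G, ℂ),
          (∀ e, y e = f (r e) * x e) →
          ψ y = π f * ψ₀ ⟨x, Submodule.subset_span hx⟩) →
        IsToeplitzRep r s ψ π) := by
  have hinj : ∀ U : Set G, IsSSection s U → Set.InjOn s U := fun U hU =>
    Set.injOn_iff_injective.2 hU.injective
  have hS := exists_mem_span_gnorm_sub_le hs hbasis (fun U hU => hinj U (hBsec U hU)) hdense
  have hgen : ∀ x (hx : x ∈ ℱ) y (hy : y ∈ ℱ), π (edgeInner hs x y) =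
      star (ψ₀ ⟨x, Submodule.subset_span hx⟩) * ψ₀ ⟨y, Submodule.subset_span hy⟩ := by
    intro x hx y hy
    refine hmul x hx y hy _ (fun e he => ?_) (fun v hv => ?_)
    · rw [edgeInner_apply_of_injOn_left hs (hinj _ (hF x hx).2) (left_ne_zero_of_mul he),
        (IsSelfAdjoint.of_nonneg ((hF x hx).1 e)).star_eq]
    · refine edgeInner_apply_eq_zero hs fun e he => ?_
      by_contra hne
      exact hv ⟨e, hne, he⟩
  have hspan := map_edgeInner_of_mem_span hs ψ₀ hgen
  have hbound : ∀ y : Submodule.span ℂ ℱ, ‖ψ₀ y‖ ≤ gnorm s ⇑(y : C_c(G, ℂ)) := fun y =>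
    norm_le_gnorm_of_map_edgeInner_self hs (hspan y y)
  refine ⟨hbound, ?_, ?_⟩
  · obtain ⟨ψ, hψ, hψb⟩ := exists_seminorm_bounded_extension (gnormSeminorm hs) hS ψ₀ hbound
    refine ⟨ψ, ⟨hψ, hψb⟩, fun ψ' ⟨hψ', hψb'⟩ => LinearMap.ext fun x => ?_⟩
    refine sub_eq_zero.1 (linearMap_eq_zero_of_seminorm_dense (gnormSeminorm hs) hS (ψ' - ψ) 2
      (fun x => ?_) (fun y hy => sub_eq_zero.2 ((hψ' ⟨y, hy⟩).trans (hψ ⟨y, hy⟩).symm)) x)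
    rw [two_mul]
    exact (norm_sub_le _ _).trans (add_le_add (hψb' x) (hψb x))
  · intro ψ hψ hψb 𝒢 h𝒢 hact
    have hinner := map_edgeInner_of_dense hs hS hψb fun x hx y hy => by
      rw [hψ ⟨x, hx⟩, hψ ⟨y, hy⟩]
      exact hspan ⟨x, hx⟩ ⟨y, hy⟩
    have hmulLeft : ∀ f ∈ 𝒢, ∀ x, ψ (leftMul hr f x) = π f * ψ x := by
      intro f hf x
      refine sub_eq_zero.1 (linearMap_eq_zero_of_seminorm_dense (gnormSeminorm hs) hS
        (ψ ∘ₗ leftMul hr f - LinearMap.mulLeft ℂ (π f) ∘ₗ ψ) (‖f‖ + ‖π f‖)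
        (fun x => ?_) (fun y hy => ?_) x)
      · rw [add_mul]
        exact (norm_sub_le _ _).trans (add_le_add
          ((hψb _).trans (gnorm_leftMul_le hs hr f x))
          ((norm_mul_le _ _).trans (mul_le_mul_of_nonneg_left (hψb x) (norm_nonneg _))))
      · refine (LinearMap.eqOn_span (f := ψ ∘ₗ leftMul hr f - LinearMap.mulLeft ℂ (π f) ∘ₗ ψ)
          (g := 0) (fun y hy => sub_eq_zero.2 ?_) hy)
        exact (hact f hf y hy _ fun e => rfl).trans
          (congrArg (π f * ·) (hψ ⟨y, Submodule.subset_span hy⟩).symm)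
    refine ⟨fun f x y hy => ?_, fun x U _ hU hxU g hg hg0 => ?_,
      fun x y Ux Uy _ _ _ _ hdisj hx hy => ?_⟩
    · rw [← map_leftMul_of_closure_adjoin_eq_univ hs hr hψb hinner h𝒢 hmulLeft f x]
      exact congrArg ψ (CompactlySupportedContinuousMap.ext hy)
    · rw [← hinner]
      congr 1
      ext v
      by_cases hv : v ∈ s '' Function.support ⇑x
      · obtain ⟨e, he, rfl⟩ := hv
        rw [hg e he, edgeInner_apply_of_injOn_left hs
          ((hinj U hU).mono ((subset_tsupport _).trans hxU)) he, Complex.star_def,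
          Complex.conj_mul']
      · rw [hg0 v hv, edgeInner_apply_eq_zero hs fun e he => ?_]
        by_contra hne
        exact hv ⟨e, left_ne_zero_of_mul hne, he⟩
    · rw [← hinner]
      have h0 : edgeInner hs x y = 0 := by
        ext v
        refine edgeInner_apply_eq_zero hs fun e _ => ?_
        by_contra hne
        exact Set.disjoint_left.1 hdisj (hx (subset_tsupport _ (left_ne_zero_of_mul hne)))
          (hy (subset_tsupport _ (right_ne_zero_of_mul hne)))
      rw [h0, map_zero]

end TopGraphPaper
end
end

section
/- Let E be a row-finite directed graph with no sources, and let Ê = (E^∞, E^∞, id, σ) be the associated topological graph. Let (ψ, π) be a covariant Toeplitz representation of Ê in a C*-algebra B. For v ∈ E⁰ define q_v = π(χ_{Z(v)}) and for e ∈ E¹ define t_e = ψ(χ_{Z(e)}), where χ denotes the characteristic function (each Z(v) and Z(e) is compact open, so these characteristic functions are compactly supported continuous functions on E^∞). Then {q_v : v ∈ E⁰} and {t_e : e ∈ E¹} form a Cuntz–Krieger E-family in B. -/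
open scoped ZeroAtInfty CompactlySupported ComplexOrder

noncomputable section

namespace TopGraphPaper

variable {V G : Type*} [TopologicalSpace V] [TopologicalSpace G]

variable {B : Type*} [NonUnitalCStarAlgebra B]

variable {V G : Type*} [TopologicalSpace V] [TopologicalSpace G]

variable {B : Type*} [NonUnitalCStarAlgebra B]

omit [TopologicalSpace V] in
instance [T2Space G] (r s : G → V) : T2Space (InfPath r s) :=
  inferInstanceAs (T2Space {z : ℕ → G // ∀ i, s (z i) = r (z (i + 1))})

omit [TopologicalSpace V] [TopologicalSpace G] in
lemma mem_cylP_singleton {r s : G → V} {e : G} {z : InfPath r s} :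
    z ∈ cylP r s [e] ↔ z.1 0 = e := by
  simp [cylP]

omit [TopologicalSpace V] in
lemma continuous_coord (r s : G → V) (i : ℕ) : Continuous fun z : InfPath r s => z.1 i :=
  (continuous_apply i).comp continuous_subtype_val

omit [TopologicalSpace V] in
lemma continuous_shift (r s : G → V) : Continuous (shift r s) :=
  Continuous.subtype_mk (continuous_pi fun i => continuous_coord r s (i + 1)) _

omit [TopologicalSpace V] in
lemma isClopen_cylP_singleton [DiscreteTopology G] (r s : G → V) (e : G) :
    IsClopen (cylP r s [e]) := by
  have : cylP r s [e] = (fun z : InfPath r s => z.1 0) ⁻¹' {e} := by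
    ext z; simp [mem_cylP_singleton]
  rw [this]
  exact (isClopen_discrete _).preimage (continuous_coord r s 0)

omit [TopologicalSpace V] in
lemma isClopen_cylV [DiscreteTopology G] (r s : G → V) (v : V) : IsClopen (cylV r s v) :=
  (isClopen_discrete {g : G | r g = v}).preimage (continuous_coord r s 0)

open Classical in
/-- The path `ez` if `z ∈ Z(s e)`, and `z` otherwise. -/
def prepend (r s : G → V) (e : G) (z : InfPath r s) : InfPath r s :=
  if h : r (z.1 0) = s e then
    ⟨fun n => Nat.casesOn n e z.1, fun n => by cases n with
      | zero => exact h.symm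
      | succ n => exact z.2 n⟩
  else z

omit [TopologicalSpace V] [TopologicalSpace G] in
lemma prepend_zero {r s : G → V} {e : G} {z : InfPath r s} (hz : z ∈ cylV r s (s e)) :
    (prepend r s e z).1 0 = e :=
  congrArg (fun w : InfPath r s => w.1 0) (dif_pos hz)

omit [TopologicalSpace V] [TopologicalSpace G] in
lemma prepend_succ {r s : G → V} {e : G} {z : InfPath r s} (hz : z ∈ cylV r s (s e)) (n : ℕ) :
    (prepend r s e z).1 (n + 1) = z.1 n :=
  congrArg (fun w : InfPath r s => w.1 (n + 1)) (dif_pos hz)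

omit [TopologicalSpace V] [TopologicalSpace G] in
lemma prepend_of_notMem {r s : G → V} {e : G} {z : InfPath r s} (hz : z ∉ cylV r s (s e)) :
    prepend r s e z = z :=
  dif_neg hz

omit [TopologicalSpace V] [TopologicalSpace G] in
lemma prepend_mem {r s : G → V} {e : G} {z : InfPath r s} (hz : z ∈ cylV r s (s e)) :
    prepend r s e z ∈ cylP r s [e] :=
  mem_cylP_singleton.2 (prepend_zero hz)

omit [TopologicalSpace V] [TopologicalSpace G] in
lemma shift_prepend {r s : G → V} {e : G} {z : InfPath r s} (hz : z ∈ cylV r s (s e)) :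
    shift r s (prepend r s e z) = z :=
  Subtype.ext (funext fun n => prepend_succ hz n)

omit [TopologicalSpace V] [TopologicalSpace G] in
lemma shift_mem {r s : G → V} {e : G} {z : InfPath r s} (hz : z ∈ cylP r s [e]) :
    shift r s z ∈ cylV r s (s e) :=
  (z.2 0).symm.trans (congrArg s (mem_cylP_singleton.1 hz))

omit [TopologicalSpace V] [TopologicalSpace G] in
lemma prepend_shift {r s : G → V} {e : G} {z : InfPath r s} (hz : z ∈ cylP r s [e]) :
    prepend r s e (shift r s z) = z := by
  refine Subtype.ext (funext fun n => ?_)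
  cases n with
  | zero => exact (prepend_zero (shift_mem hz)).trans (mem_cylP_singleton.1 hz).symm
  | succ n => exact prepend_succ (shift_mem hz) n

omit [TopologicalSpace V] in
lemma continuous_prepend [DiscreteTopology G] (r s : G → V) (e : G) :
    Continuous (prepend r s e) := by
  classical
  refine continuous_induced_rng.2 (continuous_pi fun n => ?_)
  have heq : (fun z : InfPath r s => (prepend r s e z).1 n) = fun z =>
      if z ∈ cylV r s (s e) then (Nat.casesOn n e z.1 : G) else z.1 n := by
    funext z
    by_cases h : z ∈ cylV r s (s e)
    · rw [if_pos h]
      cases n with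
      | zero => exact prepend_zero h
      | succ n => exact prepend_succ h n
    · rw [if_neg h, prepend_of_notMem h]
  change Continuous fun z : InfPath r s => (prepend r s e z).1 n
  rw [heq]
  refine Continuous.if ?_ ?_ (continuous_coord r s n)
  · intro z hz
    have := (isClopen_cylV r s (s e)).frontier_eq
    simp only [Set.ofPred_mem_eq, this] at hz
    exact hz.elim
  · cases n with
    | zero => exact continuous_const
    | succ n => exact continuous_coord r s n

omit [TopologicalSpace V] in
lemma isSSection_cylP_singleton [DiscreteTopology G] (r s : G → V) (e : G) :
    IsSSection (shift r s) (cylP r s [e]) := by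
  refine Topology.IsEmbedding.of_comp
    ((continuous_shift r s).comp continuous_subtype_val) (continuous_prepend r s e) ?_
  convert! Topology.IsEmbedding.subtypeVal (p := (· ∈ cylP r s [e])) using 1
  funext z
  exact prepend_shift z.2

omit [TopologicalSpace V] in
/-- Pushing a compactly supported function forward along `σ : Z(e) → Z(s e)`. -/
lemma exists_pushforward_s18 [DiscreteTopology G] (r s : G → V) (e : G)
    (y : C_c(InfPath r s, ℂ)) :
    ∃ w : C₀(InfPath r s, ℂ), (∀ z ∈ cylP r s [e], w (shift r s z) = y z) ∧
      ∀ z ∉ cylV r s (s e), w z = 0 := by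
  have hcont : Continuous ((cylV r s (s e)).indicator fun z => y (prepend r s e z)) :=
    (y.continuous.comp (continuous_prepend r s e)).indicator fun z hz => by
      simp [(isClopen_cylV r s (s e)).frontier_eq] at hz
  refine ⟨⟨⟨_, hcont⟩, HasCompactSupport.is_zero_at_infty (HasCompactSupport.intro
    (y.hasCompactSupport.isCompact.image (continuous_shift r s)) fun z hz => ?_)⟩, ?_, ?_⟩
  · by_contra h
    have h' : (cylV r s (s e)).indicator (fun z => y (prepend r s e z)) z ≠ 0 := h
    have hz' := Set.mem_of_indicator_ne_zero h'
    rw [Set.indicator_of_mem hz'] at h'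
    exact hz ⟨_, subset_tsupport _ h', shift_prepend hz'⟩
  · intro z hz
    exact (Set.indicator_of_mem (shift_mem hz) fun z => y (prepend r s e z)).trans
      (congrArg y (prepend_shift hz))
  · intro z hz
    exact Set.indicator_of_notMem hz fun z => y (prepend r s e z)

/-- Polarization: a sesquilinear product is determined by its quadratic form. -/
lemma star_mul_eq_of_forall_smul {A t D P : B}
    (h : ∀ c : ℂ, star (A + c • t) * (A + c • t) = star (D + c • P) * (D + c • P)) :
    star A * t = star D * P := by
  have h1 := h 1
  have h2 := h (-1)
  have h3 := congrArg (Complex.I • ·) (h Complex.I)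
  have h4 := congrArg (Complex.I • ·) (h (-Complex.I))
  simp only [star_add, star_smul, add_mul, mul_add, smul_mul_assoc, mul_smul_comm, smul_add,
    smul_smul, smul_neg, Complex.star_def, Complex.conj_I, neg_neg, neg_mul, mul_neg,
    Complex.I_mul_I, star_neg, one_smul, neg_smul] at h1 h2 h3 h4
  linear_combination (norm := module) (1 / 4 : ℂ) • (h1 - h2 - h3 + h4)

section Representation

variable {r s : G → V} {ψ : C_c(InfPath r s, ℂ) →ₗ[ℂ] B} {π : C₀(InfPath r s, ℂ) →⋆ₙₐ[ℂ] B}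

omit [TopologicalSpace V] in
lemma star_mul_self_of_pushforward [DiscreteTopology G]
    (hT : IsToeplitzRep (id : InfPath r s → InfPath r s) (shift r s) ψ π) {e : G}
    {y : C_c(InfPath r s, ℂ)} {w : C₀(InfPath r s, ℂ)} (hy : ∀ z ∉ cylP r s [e], y z = 0)
    (hw : ∀ z ∈ cylP r s [e], w (shift r s z) = y z) (hw0 : ∀ z ∉ cylV r s (s e), w z = 0) :
    star (ψ y) * ψ y = star (π w) * π w := by
  have hsupp : Function.support ⇑y ⊆ cylP r s [e] := fun z hz => by
    by_contra h
    exact hz (hy z h)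
  rw [← map_star π, ← map_mul π]
  refine (hT.inner y _ (isClopen_cylP_singleton r s e).isOpen (isSSection_cylP_singleton r s e)
    (closure_minimal hsupp (isClopen_cylP_singleton r s e).isClosed) _ ?_ ?_).symm
  · intro z hz
    simp [hw z (hsupp hz), Complex.conj_mul']
  · intro z hz
    suffices w z = 0 by simp [this]
    by_contra h
    have hz' : z ∈ cylV r s (s e) := by
      by_contra h'
      exact h (hw0 z h')
    refine hz ⟨_, ?_, shift_prepend hz'⟩
    rwa [Function.mem_support, ← hw _ (prepend_mem hz'), shift_prepend hz']

omit [TopologicalSpace V] in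
lemma star_mul_of_pushforward [DiscreteTopology G]
    (hT : IsToeplitzRep (id : InfPath r s → InfPath r s) (shift r s) ψ π) {e : G}
    {y y' : C_c(InfPath r s, ℂ)} {w w' : C₀(InfPath r s, ℂ)}
    (hy : ∀ z ∉ cylP r s [e], y z = 0) (hy' : ∀ z ∉ cylP r s [e], y' z = 0)
    (hw : ∀ z ∈ cylP r s [e], w (shift r s z) = y z)
    (hw' : ∀ z ∈ cylP r s [e], w' (shift r s z) = y' z)
    (hw0 : ∀ z ∉ cylV r s (s e), w z = 0) (hw0' : ∀ z ∉ cylV r s (s e), w' z = 0) :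
    star (ψ y) * ψ y' = star (π w) * π w' := by
  refine star_mul_eq_of_forall_smul fun c => ?_
  rw [← map_smul, ← map_smul, ← map_add, ← map_add]
  refine star_mul_self_of_pushforward hT (e := e) ?_ ?_ ?_
  · intro z hz
    simp [hy z hz, hy' z hz]
  · intro z hz
    simp [hw z hz, hw' z hz]
  · intro z hz
    simp [hw0 z hz, hw0' z hz]

omit [TopologicalSpace V] in
/-- The right-module property of `ψ` for functions supported in `Z(e)`. -/
lemma map_eq_mul_of_pushforward [DiscreteTopology G]
    (hT : IsToeplitzRep (id : InfPath r s → InfPath r s) (shift r s) ψ π) {e : G}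
    {x y : C_c(InfPath r s, ℂ)} {w : C₀(InfPath r s, ℂ)}
    (hx : ∀ z, x z = (cylP r s [e]).indicator (fun _ => (1 : ℂ)) z)
    (hy : ∀ z ∉ cylP r s [e], y z = 0)
    (hw : ∀ z ∈ cylP r s [e], w (shift r s z) = y z) (hw0 : ∀ z ∉ cylV r s (s e), w z = 0) :
    ψ y = ψ x * π w := by
  obtain ⟨p, hp, hp0⟩ := exists_pushforward_s18 r s e x
  have hx0 : ∀ z ∉ cylP r s [e], x z = 0 := fun z hz => by rw [hx, Set.indicator_of_notMem hz]
  have hp1 : ∀ z ∈ cylV r s (s e), p z = 1 := fun z hz => by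
    have h := hp _ (prepend_mem hz)
    rwa [shift_prepend hz, hx, Set.indicator_of_mem (prepend_mem hz)] at h
  have hps : star (π p) = π p := by
    rw [← map_star]
    congr 1
    ext z
    by_cases hz : z ∈ cylV r s (s e) <;> simp [hp1, hp0, hz]
  have hpw : π p * π w = π w := by
    rw [← map_mul]
    congr 1
    ext z
    by_cases hz : z ∈ cylV r s (s e) <;> simp [hp1, hw0, hz]
  have hwp : star (π w) * π p = star (π w) := by simpa [hps] using congrArg star hpw
  have hxx := star_mul_of_pushforward hT hx0 hx0 hp hp hp0 hp0
  have hxy := star_mul_of_pushforward hT hx0 hy hp hw hp0 hw0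
  have hyx := star_mul_of_pushforward hT hy hx0 hw hp hw0 hp0
  have hyy := star_mul_of_pushforward hT hy hy hw hw hw0 hw0
  rw [← sub_eq_zero, ← CStarRing.star_mul_self_eq_zero_iff]
  rw [hps, hpw] at hxy
  rw [hwp] at hyx
  have h3 : star (π w) * (star (ψ x) * ψ y) = star (π w) * π w := by rw [hxy]
  have h4 : star (ψ y) * ψ x * π w = star (π w) * π w := by rw [hyx]
  have h5 : star (π w) * (star (ψ x) * ψ x) * π w = star (π w) * π w := by
    rw [hxx, hps, ← mul_assoc, hwp, hwp]
  simp only [star_sub, star_mul, sub_mul, mul_sub, ← mul_assoc] at h3 h4 h5 ⊢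
  rw [hyy, h3, h4, h5]
  simp

/-- `Ê⁰_rg` is everything as `r̂` is the identity and `E^∞` is locally compact. -/
lemma Erg_id_eq_univ {X : Type*} [TopologicalSpace X] [WeaklyLocallyCompactSpace X] :
    Erg (id : X → X) = Set.univ := by
  ext x
  obtain ⟨K, hK, hxK⟩ := exists_compact_mem_nhds x
  simp only [Erg, Esce, Efin]
  simpa using ⟨K, hxK, hK⟩

omit [TopologicalSpace V] in
lemma weaklyLocallyCompactSpace_infPath [DiscreteTopology G]
    (h : ∀ e : G, ∃ x : C_c(InfPath r s, ℂ),
      ∀ z, x z = (cylP r s [e]).indicator (fun _ => (1 : ℂ)) z) :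
    WeaklyLocallyCompactSpace (InfPath r s) := by
  refine ⟨fun z => ⟨cylP r s [z.1 0], ?_, (isClopen_cylP_singleton r s _).isOpen.mem_nhds
    (mem_cylP_singleton.2 rfl)⟩⟩
  obtain ⟨x, hx⟩ := h (z.1 0)
  refine x.hasCompactSupport.isCompact.of_isClosed_subset
    (isClopen_cylP_singleton r s _).isClosed fun z' hz' => subset_tsupport _ ?_
  simp [hx, hz']

/-- If `Ê⁰_rg` is everything, an element annihilating the range of `ψ` annihilates the range
of `π`. -/
lemma mul_map_eq_zero_of_covariant {X Y : Type*} [TopologicalSpace X] [TopologicalSpace Y]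
    {ρ τ : Y → X} {φ : C_c(Y, ℂ) →ₗ[ℂ] B} {θ : C₀(X, ℂ) →⋆ₙₐ[ℂ] B}
    (hCov : IsCovariant ρ τ φ θ) (hrg : Erg ρ = Set.univ) {d : B} (hd : ∀ y, d * φ y = 0)
    (f : C₀(X, ℂ)) : d * θ f = 0 := by
  obtain ⟨𝒢, h𝒢, hdense, hcov⟩ := hCov
  have hgen : ∀ f ∈ 𝒢, d * θ f = 0 := fun f hf => by
    obtain ⟨𝒩, gN, -, -, -, -, hf⟩ := hcov f hf
    rw [hf, Finset.mul_sum]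
    exact Finset.sum_eq_zero fun N _ => by rw [← mul_assoc, hd, zero_mul]
  have hadj : ∀ f ∈ NonUnitalStarAlgebra.adjoin ℂ 𝒢, d * θ f = 0 ∧ d * θ (star f) = 0 := by
    intro f hf
    induction hf using NonUnitalStarAlgebra.adjoin_induction with
    | mem f hf =>
      have hstar : star f = f := by
        ext z
        exact Complex.conj_eq_iff_im.2 (Complex.nonneg_iff.1 ((h𝒢 f hf).2.1 z)).2.symm
      rw [hstar]
      exact ⟨hgen f hf, hgen f hf⟩
    | add f g _ _ hf hg => simp [mul_add, hf.1, hf.2, hg.1, hg.2]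
    | zero => simp
    | mul f g _ _ hf hg => simp [← mul_assoc, hf.1, hf.2]
    | smul c f _ hf => simp [mul_smul_comm, hf.1, hf.2]
    | star f _ hf => simpa using hf.symm
  have hθ : Continuous θ :=
    AddMonoidHomClass.continuous_of_bound θ 1 fun a => by
      simpa using NonUnitalStarAlgHom.norm_apply_le θ a
  have hclosed : IsClosed {f : C₀(X, ℂ) | d * θ f = 0} :=
    isClosed_eq (continuous_const.mul hθ) continuous_const
  refine closure_minimal (fun g hg => (hadj g hg).1) hclosed ?_
  rw [hdense, hrg]
  simp

omit [TopologicalSpace V] in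
/-- The vertex projection of `Z(e)` is the range projection of `t_e`. -/
lemma map_indicator_cylP_eq [DiscreteTopology G]
    (hT : IsToeplitzRep (id : InfPath r s → InfPath r s) (shift r s) ψ π)
    (hCov : IsCovariant (id : InfPath r s → InfPath r s) (shift r s) ψ π)
    (hrg : Erg (id : InfPath r s → InfPath r s) = Set.univ) {e : G}
    {x : C_c(InfPath r s, ℂ)} {p : C₀(InfPath r s, ℂ)}
    (hx : ∀ z, x z = (cylP r s [e]).indicator (fun _ => (1 : ℂ)) z) (hp : ∀ z, p z = x z) :
    π p = ψ x * star (ψ x) := by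
  have hpp : π p * π p = π p := by
    rw [← map_mul]
    congr 1
    ext z
    by_cases hz : z ∈ cylP r s [e] <;> simp [hp, hx, hz]
  have hps : star (π p) = π p := by
    rw [← map_star]
    congr 1
    ext z
    by_cases hz : z ∈ cylP r s [e] <;> simp [hp, hx, hz]
  have hpx : π p * ψ x = ψ x := by
    refine (hT.act p x x fun z => ?_).symm
    by_cases hz : z ∈ cylP r s [e] <;> simp [hp, hx, hz]
  have hxp : star (ψ x) * π p = star (ψ x) := by
    simpa [hps] using congrArg star hpx
  have hx0 : ∀ z ∉ cylP r s [e], x z = 0 := fun z hz => by rw [hx, Set.indicator_of_notMem hz]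
  have hxxx : ψ x * star (ψ x) * ψ x = ψ x := by
    obtain ⟨w, hw, hw0⟩ := exists_pushforward_s18 r s e x
    have hww : star (π w) * π w = π w := by
      rw [← map_star, ← map_mul]
      congr 1
      ext z
      by_cases hz : z ∈ cylV r s (s e)
      · have h := hw _ (prepend_mem hz)
        rw [shift_prepend hz, hx, Set.indicator_of_mem (prepend_mem hz)] at h
        simp [h]
      · simp [hw0 z hz]
    rw [mul_assoc, star_mul_self_of_pushforward hT hx0 hw hw0, hww]
    exact (map_eq_mul_of_pushforward hT hx hx0 hw hw0).symm
  have hd : ∀ y, (π p - ψ x * star (ψ x)) * ψ y = 0 := by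
    intro y
    let y' : C_c(InfPath r s, ℂ) := x * y
    have hy' : ψ y' = π p * ψ y := hT.act p y y' fun z => by simp [y', hp]
    obtain ⟨w, hw, hw0⟩ := exists_pushforward_s18 r s e y'
    have hyw := map_eq_mul_of_pushforward hT hx (y := y')
      (fun z hz => by simp [y', hx0 z hz]) hw hw0
    calc (π p - ψ x * star (ψ x)) * ψ y
        = (π p - ψ x * star (ψ x)) * (π p * ψ y) := by
          rw [← mul_assoc _ (π p), sub_mul (π p) _ (π p), hpp, mul_assoc (ψ x), hxp]
      _ = 0 := by
          rw [← hy', hyw, ← mul_assoc, sub_mul, hpx, hxxx, sub_self, zero_mul]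
  have h := mul_map_eq_zero_of_covariant hCov hrg hd p
  rwa [sub_mul, hpp, mul_assoc, hxp, sub_eq_zero] at h

end Representation

/-- If `(ψ, π)` is a covariant Toeplitz representation of
`Ê = (E^∞, E^∞, id, σ)` in `B`, then `q_v := π(χ_{Z(v)})` and `t_e := ψ(χ_{Z(e)})` form a
Cuntz–Krieger `E`-family in `B`. -/
theorem statement18 {V G : Type*} [TopologicalSpace V] [TopologicalSpace G]
    [DiscreteTopology V] [DiscreteTopology G] [Countable V] [Countable G]
    (r s : G → V) (hrow : ∀ v : V, (r ⁻¹' {v}).Finite)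
    (hsrc : ∀ v : V, (r ⁻¹' {v}).Nonempty)
    {B : Type*} [NonUnitalCStarAlgebra B]
    (ψ : C_c(InfPath r s, ℂ) →ₗ[ℂ] B) (π : C₀(InfPath r s, ℂ) →⋆ₙₐ[ℂ] B)
    (hT : IsToeplitzRep (id : InfPath r s → InfPath r s) (shift r s) ψ π)
    (hCov : IsCovariant (id : InfPath r s → InfPath r s) (shift r s) ψ π)
    (Q : V → B) (T : G → B)
    (hQ : ∀ v : V, ∃ f : C₀(InfPath r s, ℂ),
      (∀ z, f z = (cylV r s v).indicator (fun _ => (1 : ℂ)) z) ∧ Q v = π f)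
    (hTe : ∀ e : G, ∃ x : C_c(InfPath r s, ℂ),
      (∀ z, x z = (cylP r s [e]).indicator (fun _ => (1 : ℂ)) z) ∧ T e = ψ x) :
    IsCKFamily r s Q T := by
  choose f hf hQf using hQ
  choose x hx hTx using hTe
  have := weaklyLocallyCompactSpace_infPath fun e => ⟨x e, hx e⟩
  have hf1 : ∀ v z, z ∈ cylV r s v → f v z = 1 := fun v z hz => by simp [hf, hz]
  have hf0 : ∀ v z, z ∉ cylV r s v → f v z = 0 := fun v z hz => by simp [hf, hz]
  refine ⟨fun v => ?_, fun v w hvw => ?_, fun e => ?_, fun v F hF => ?_⟩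
  · rw [hQf, ← map_star, ← map_mul]
    constructor <;> congr 1 <;> ext z <;> by_cases hz : z ∈ cylV r s v <;>
      simp [hf1, hf0, hz]
  · have : f v * f w = 0 := by
      ext z
      by_cases hz : z ∈ cylV r s v
      · have hz' : z ∉ cylV r s w := fun h => hvw (hz.symm.trans h)
        simp [hf0 w z hz']
      · simp [hf0 v z hz]
    rw [hQf, hQf, ← map_mul, this, map_zero]
  · rw [hTx, star_mul_self_of_pushforward hT (e := e) (w := f (s e)), hQf, ← map_star, ← map_mul]
    · congr 1
      ext z
      by_cases hz : z ∈ cylV r s (s e) <;> simp [hf1, hf0, hz]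
    · intro z hz
      simp [hx, hz]
    · intro z hz
      simp [hf1 _ _ (shift_mem hz), hx, hz]
    · exact hf0 (s e)
  · let p : G → C₀(InfPath r s, ℂ) := fun e => ⟨⟨x e, (x e).continuous⟩,
      (x e).hasCompactSupport.is_zero_at_infty⟩
    have hfp : f v = ∑ e ∈ F, p e := by
      ext z
      have hsum : (∑ e ∈ F, p e) z = ∑ e ∈ F, x e z :=
        map_sum (AddMonoidHom.mk' (fun g : C₀(InfPath r s, ℂ) => g z) fun _ _ => rfl) p F
      classical
      rw [hsum, hf]
      simp [hx, Set.indicator_apply, mem_cylP_singleton, hF, cylV]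
    rw [hQf, hfp, map_sum]
    refine Finset.sum_congr rfl fun e _ => ?_
    rw [hTx]
    exact map_indicator_cylP_eq hT hCov Erg_id_eq_univ (hx e) fun _ => rfl

end TopGraphPaper
end
end
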